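/- (Nirenberg's interior estimate.) There exist constants ᾱ ∈ (0,1) and C > 0 depending only on λ and Λ such that the following holds. Let u ∈ C²(B̄₁), with B₁ ⊂ ℝ² the unit disk, be a classical solution of F(D²u) = 0 in B₁, where F is of class C¹, uniformly elliptic with constants λ, Λ, and F(0) = 0. Then u ∈ C^{2,ᾱ}(B̄_{1/2}) and ‖u‖_{C^{2,ᾱ}(B̄_{1/2})} ≤ C‖u‖_{L^∞(B₁)}. -/

import Mathlib

open Metric Set Real
open scoped Classical

noncomputable section

abbrev E2 : Type := EuclideanSpace ℝ (Fin 2)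
abbrev Mat2 : Type := Matrix (Fin 2) (Fin 2) ℝ

/-- `‖A⁺‖`: the sum of the positive parts of the eigenvalues of a symmetric matrix `A`. -/
noncomputable def posNorm (A : Mat2) : ℝ :=
  if h : A.IsHermitian then ∑ i, max (h.eigenvalues i) 0 else 0

/-- `‖A⁻‖`: the sum of the negative parts of the eigenvalues of a symmetric matrix `A`. -/
noncomputable def negNorm (A : Mat2) : ℝ :=
  if h : A.IsHermitian then ∑ i, max (-(h.eigenvalues i)) 0 else 0

/-- A norm on 2×2 matrices: sum of absolute values of entries. -/
noncomputable def matNorm (A : Mat2) : ℝ := ∑ i, ∑ j, |A i j|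

/-- `F` is uniformly elliptic with constants `0 < lam ≤ Lam`:
`F M - F N ≤ Lam ‖(M-N)⁺‖ - lam ‖(M-N)⁻‖` for all symmetric `M, N`. -/
def UniformlyElliptic (lam Lam : ℝ) (F : Mat2 → ℝ) : Prop :=
  ∀ M N : Mat2, M.IsHermitian → N.IsHermitian →
    F M - F N ≤ Lam * posNorm (M - N) - lam * negNorm (M - N)

/-- The Hessian matrix `D²u(x)` of `u : ℝ² → ℝ` at `x`. -/
noncomputable def hess (u : E2 → ℝ) (x : E2) : Mat2 :=
  Matrix.of fun i j =>
    fderiv ℝ (fun y => fderiv ℝ u y (EuclideanSpace.single j 1)) x (EuclideanSpace.single i 1)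

/-- `sup_s |u|`, the `L^∞` norm of `u` on `s`. -/
noncomputable def supAbs (u : E2 → ℝ) (s : Set E2) : ℝ := ⨆ x ∈ s, |u x|

section Helpers

open MeasureTheory Filter Topology

lemma nl_cc (φ q : ℝ × ℝ → ℝ) (hφ : ContDiff ℝ 1 φ) (hφc : HasCompactSupport φ)
    (hq : ContDiff ℝ 1 q) (hqc : HasCompactSupport q) :
    ∫ z, fderiv ℝ q z (0, 1) * fderiv ℝ φ z (1, 0)
      = ∫ z, fderiv ℝ φ z (0, 1) * fderiv ℝ q z (1, 0) := by
  obtain ⟨Cq, hLq⟩ := hq.lipschitzWith_of_hasCompactSupport hqc one_ne_zero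
  obtain ⟨Cφ, hLφ⟩ := hφ.lipschitzWith_of_hasCompactSupport hφc one_ne_zero
  have cφ1 : Continuous fun z => fderiv ℝ φ z (1, 0) :=
    (hφ.continuous_fderiv one_ne_zero).clm_apply continuous_const
  have cq1 : Continuous fun z => fderiv ℝ q z (1, 0) :=
    (hq.continuous_fderiv one_ne_zero).clm_apply continuous_const
  have T1 := hLq.integral_inv_smul_sub_mul_tendsto_integral_lineDeriv_mul' (μ := volume)
    hqc cφ1 ((0, 1) : ℝ × ℝ)
  have T2 := hLφ.integral_inv_smul_sub_mul_tendsto_integral_lineDeriv_mul' (μ := volume)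
    hφc cq1 (-((0, 1) : ℝ × ℝ))
  have dq : ∀ z, DifferentiableAt ℝ q z := fun z => (hq.differentiable one_ne_zero) z
  have dφ : ∀ z, DifferentiableAt ℝ φ z := fun z => (hφ.differentiable one_ne_zero) z
  have lq : ∀ z v, lineDeriv ℝ q z v = fderiv ℝ q z v := fun z v => (dq z).lineDeriv_eq_fderiv
  have lφ : ∀ z v, lineDeriv ℝ φ z v = fderiv ℝ φ z v := fun z v => (dφ z).lineDeriv_eq_fderiv
  simp_rw [lq] at T1
  simp_rw [lφ] at T2
  have T2' := T2.neg
  have hcφ1 : HasCompactSupport fun z => fderiv ℝ φ z (1, 0) := by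
    refine (hφc.fderiv ℝ).mono' ?_
    intro z hz
    apply subset_closure
    intro h; apply hz; simp [h]
  have hcq1 : HasCompactSupport fun z => fderiv ℝ q z (1, 0) := by
    refine (hqc.fderiv ℝ).mono' ?_
    intro z hz
    apply subset_closure
    intro h; apply hz; simp [h]
  have key : ∀ t : ℝ, (∫ x, (t⁻¹ • (q (x + t • ((0, 1) : ℝ × ℝ)) - q x)) * fderiv ℝ φ x (1, 0))
      = - ∫ x, (t⁻¹ • (φ (x + t • (-((0, 1) : ℝ × ℝ))) - φ x)) * fderiv ℝ q x (1, 0) := by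
    intro t
    set e : ℝ × ℝ := t • (0, 1) with he
    have IBP : ∀ (g : ℝ × ℝ → ℝ), ContDiff ℝ 1 g →
        ∫ x, g x * fderiv ℝ φ x (1, 0) = - ∫ x, fderiv ℝ g x (1, 0) * φ x := by
      intro g hg
      have cg1 : Continuous fun z => fderiv ℝ g z (1, 0) :=
        (hg.continuous_fderiv one_ne_zero).clm_apply continuous_const
      apply integral_mul_fderiv_eq_neg_fderiv_mul_of_integrable
      · exact (cg1.mul hφ.continuous).integrable_of_hasCompactSupport hφc.mul_left
      · exact (hg.continuous.mul cφ1).integrable_of_hasCompactSupport hcφ1.mul_left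
      · exact (hg.continuous.mul hφ.continuous).integrable_of_hasCompactSupport hφc.mul_left
      · intro x _; exact hg.differentiable one_ne_zero x
      · intro x _; exact dφ x
    have hqs : ContDiff ℝ 1 (fun x => q (x + e)) := hq.comp (contDiff_id.add contDiff_const)
    have A1 := IBP _ hqs
    have A2 := IBP _ hq
    have fs : ∀ x, fderiv ℝ (fun x => q (x + e)) x = fderiv ℝ q (x + e) := by
      intro x; exact fderiv_comp_add_right e
    simp_rw [fs] at A1
    have A3 : ∫ x, fderiv ℝ q (x + e) (1, 0) * φ x = ∫ x, fderiv ℝ q x (1, 0) * φ (x - e) := by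
      rw [← integral_add_right_eq_self (fun x => fderiv ℝ q x (1, 0) * φ (x - e)) e]
      simp
    have I1 : Integrable fun x => q (x + e) * fderiv ℝ φ x (1, 0) :=
      (hqs.continuous.mul cφ1).integrable_of_hasCompactSupport hcφ1.mul_left
    have I2 : Integrable fun x => q x * fderiv ℝ φ x (1, 0) :=
      (hq.continuous.mul cφ1).integrable_of_hasCompactSupport hcφ1.mul_left
    have cφs : Continuous fun x => φ (x - e) := hφ.continuous.comp (continuous_id.sub continuous_const)
    have I3 : Integrable fun x => fderiv ℝ q x (1, 0) * φ (x - e) :=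
      (cq1.mul cφs).integrable_of_hasCompactSupport hcq1.mul_right
    have I4 : Integrable fun x => fderiv ℝ q x (1, 0) * φ x :=
      (cq1.mul hφ.continuous).integrable_of_hasCompactSupport hcq1.mul_right
    have L : ∀ x, (t⁻¹ • (q (x + e) - q x)) * fderiv ℝ φ x (1, 0)
        = t⁻¹ * (q (x + e) * fderiv ℝ φ x (1, 0) - q x * fderiv ℝ φ x (1, 0)) := by
      intro x; simp only [smul_eq_mul]; ring
    have R : ∀ x, (t⁻¹ • (φ (x + t • (-((0, 1) : ℝ × ℝ))) - φ x)) * fderiv ℝ q x (1, 0)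
        = t⁻¹ * (fderiv ℝ q x (1, 0) * φ (x - e) - fderiv ℝ q x (1, 0) * φ x) := by
      intro x
      have : x + t • (-((0, 1) : ℝ × ℝ)) = x - e := by rw [smul_neg, sub_eq_add_neg]
      rw [this]; simp only [smul_eq_mul]; ring
    simp_rw [L, R]
    rw [integral_const_mul, integral_const_mul, integral_sub I1 I2, integral_sub I3 I4, A1, A2, A3]
    ring
  simp_rw [key] at T1
  have := tendsto_nhds_unique T1 T2'
  rw [this, ← integral_neg]
  simp only [map_neg, neg_mul, neg_neg]

lemma null_lag (φ q : ℝ × ℝ → ℝ) (hφ : ContDiff ℝ 1 φ) (hφc : HasCompactSupport φ)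
    (hq : ContDiff ℝ 1 q) :
    ∫ z, (fderiv ℝ φ z (1, 0) * fderiv ℝ q z (0, 1)
      - fderiv ℝ φ z (0, 1) * fderiv ℝ q z (1, 0)) = 0 := by
  obtain ⟨R, hR0, hR⟩ : ∃ R, 0 < R ∧ tsupport φ ⊆ ball 0 R := by
    obtain ⟨R, hR⟩ := hφc.isCompact.isBounded.subset_ball (0 : ℝ × ℝ)
    exact ⟨max R 1, by positivity, hR.trans (ball_subset_ball (le_max_left _ _))⟩
  let χ : ContDiffBump (0 : ℝ × ℝ) := ⟨R, R + 1, hR0, by linarith⟩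
  have hq' : ContDiff ℝ 1 (fun z => χ z * q z) := χ.contDiff.mul hq
  have hqc' : HasCompactSupport (fun z => χ z * q z) := χ.hasCompactSupport.mul_right
  have h := nl_cc φ _ hφ hφc hq' hqc'
  have hz : ∀ z, z ∉ tsupport φ → fderiv ℝ φ z = 0 := by
    intro z hz
    exact image_eq_zero_of_notMem_tsupport fun h => hz (tsupport_fderiv_subset ℝ h)
  have he : ∀ z, z ∈ tsupport φ → fderiv ℝ (fun z => χ z * q z) z = fderiv ℝ q z := by
    intro z hz
    apply Filter.EventuallyEq.fderiv_eq
    filter_upwards [χ.eventuallyEq_one_of_mem_ball (hR hz)] with y hy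
    simp [hy]
  have e1 : ∀ z, fderiv ℝ (fun z => χ z * q z) z (0, 1) * fderiv ℝ φ z (1, 0)
      = fderiv ℝ φ z (1, 0) * fderiv ℝ q z (0, 1) := by
    intro z
    by_cases h : z ∈ tsupport φ
    · rw [he z h, mul_comm]
    · rw [hz z h]; simp
  have e2 : ∀ z, fderiv ℝ φ z (0, 1) * fderiv ℝ (fun z => χ z * q z) z (1, 0)
      = fderiv ℝ φ z (0, 1) * fderiv ℝ q z (1, 0) := by
    intro z
    by_cases h : z ∈ tsupport φ
    · rw [he z h]
    · rw [hz z h]; simp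
  simp_rw [e1, e2] at h
  have hcs : ∀ v, HasCompactSupport fun z => fderiv ℝ φ z v := by
    intro v
    refine (hφc.fderiv ℝ).mono' ?_
    intro z hz
    apply subset_closure
    intro h; apply hz; simp [h]
  have cc : ∀ (g : ℝ × ℝ → ℝ) (_ : ContDiff ℝ 1 g) v, Continuous fun z => fderiv ℝ g z v :=
    fun g hg v => (hg.continuous_fderiv one_ne_zero).clm_apply continuous_const
  rw [integral_sub, h, sub_self]
  · exact ((cc φ hφ _).mul (cc q hq _)).integrable_of_hasCompactSupport (hcs _).mul_right
  · exact ((cc φ hφ _).mul (cc q hq _)).integrable_of_hasCompactSupport (hcs _).mul_right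

def QR (K : ℝ) (p q : ℝ × ℝ → ℝ) (s : Set (ℝ × ℝ)) : Prop :=
  ∀ z ∈ s, (fderiv ℝ p z (1, 0)) ^ 2 + (fderiv ℝ p z (0, 1)) ^ 2
      + (fderiv ℝ q z (1, 0)) ^ 2 + (fderiv ℝ q z (0, 1)) ^ 2
    ≤ -K * (fderiv ℝ p z (1, 0) * fderiv ℝ q z (0, 1)
      - fderiv ℝ p z (0, 1) * fderiv ℝ q z (1, 0))

lemma hasDerivAt_max_sq (s : ℝ) : HasDerivAt (fun t : ℝ => (max t 0) ^ 2) (2 * max s 0) s := by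
  rcases lt_trichotomy s 0 with h | h | h
  · rw [max_eq_right h.le, mul_zero]
    refine (hasDerivAt_const s (0 : ℝ)).congr_of_eventuallyEq ?_
    filter_upwards [gt_mem_nhds h] with t ht
    rw [max_eq_right ht.le]; simp
  · subst h
    simp only [max_self, mul_zero]
    rw [hasDerivAt_iff_isLittleO]
    simp only [max_self, sub_zero, smul_zero, ne_eq, OfNat.ofNat_ne_zero, not_false_eq_true, zero_pow]
    have : (fun t : ℝ => t ^ 2) =o[𝓝 0] fun t => t := by
      simpa using (Asymptotics.isLittleO_pow_id (𝕜 := ℝ) (n := 2) (by norm_num))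
    refine Asymptotics.IsBigO.trans_isLittleO ?_ this
    apply Asymptotics.IsBigO.of_bound 1
    filter_upwards with t
    simp only [norm_pow, one_mul]
    apply pow_le_pow_left₀ (norm_nonneg _)
    simp only [Real.norm_eq_abs]
    rw [abs_of_nonneg (le_max_right _ _)]
    exact max_le (le_abs_self _) (abs_nonneg _)
  · rw [max_eq_left h.le]
    have := (hasDerivAt_pow 2 s)
    refine (this.congr_of_eventuallyEq ?_).congr_deriv (by simp)
    filter_upwards [lt_mem_nhds h] with t ht
    rw [max_eq_left ht.le]

lemma contDiff_max_sq : ContDiff ℝ 1 (fun t : ℝ => (max t 0) ^ 2) := by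
  rw [contDiff_one_iff_deriv]
  refine ⟨fun s => (hasDerivAt_max_sq s).differentiableAt, ?_⟩
  have : deriv (fun t : ℝ => (max t 0) ^ 2) = fun s => 2 * max s 0 := by
    ext s; exact (hasDerivAt_max_sq s).deriv
  rw [this]; fun_prop

lemma cont_dir (g : ℝ × ℝ → ℝ) (hg : ContDiff ℝ 1 g) (v : ℝ × ℝ) :
    Continuous fun z => fderiv ℝ g z v :=
  (hg.continuous_fderiv one_ne_zero).clm_apply continuous_const

lemma max_principle {K : ℝ} (hK : 0 < K) (p q : ℝ × ℝ → ℝ) (hp : ContDiff ℝ 1 p)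
    (hq : ContDiff ℝ 1 q) {ρ : ℝ} (hρ : 0 < ρ) (hQ : QR K p q (ball 0 ρ)) (k : ℝ)
    (hk : ∀ z ∈ sphere (0 : ℝ × ℝ) ρ, p z ≤ k) : ∀ z ∈ closedBall (0 : ℝ × ℝ) ρ, p z ≤ k := by
  intro z0 hz0
  by_contra hcon
  push Not at hcon
  obtain ⟨m, hkm, hm⟩ := exists_between hcon
  have hScomp : IsCompact (closedBall (0 : ℝ × ℝ) ρ ∩ {z | m ≤ p z}) :=
    (isCompact_closedBall _ _).inter_right (isClosed_le continuous_const hp.continuous)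
  obtain ⟨z1, hz1, hz1max⟩ := hScomp.exists_isMaxOn ⟨z0, hz0, hm.le⟩ continuous_norm.continuousOn
  have hz1ρ : ‖z1‖ < ρ := by
    have h1 : ‖z1‖ ≤ ρ := by simpa using hz1.1
    rcases h1.lt_or_eq with h | h
    · exact h
    · exfalso
      have := hk z1 (by simpa using h)
      have h2 : m ≤ p z1 := hz1.2
      linarith
  have hz0ρ : ‖z0‖ < ρ := by
    have : ‖z0‖ ≤ ‖z1‖ := hz1max (show z0 ∈ _ from ⟨hz0, hm.le⟩)
    linarith
  let χ : ContDiffBump (0 : ℝ × ℝ) := ⟨(‖z1‖ + ρ) / 2, ρ, by positivity, by linarith⟩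
  have hψ : ContDiff ℝ 1 (fun z => (max (p z - m) 0) ^ 2) :=
    contDiff_max_sq.comp (hp.sub contDiff_const)
  set φ : ℝ × ℝ → ℝ := fun z => χ z * (max (p z - m) 0) ^ 2 with hφdef
  have hφ : ContDiff ℝ 1 φ := χ.contDiff.mul hψ
  have hφc : HasCompactSupport φ := χ.hasCompactSupport.mul_right
  have hD : ∀ z, fderiv ℝ φ z = (2 * χ z * max (p z - m) 0) • fderiv ℝ p z := by
    intro z
    have dp : HasFDerivAt p (fderiv ℝ p z) z := (hp.differentiable one_ne_zero z).hasFDerivAt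
    have dψ : HasFDerivAt (fun z => (max (p z - m) 0) ^ 2)
        ((2 * max (p z - m) 0) • fderiv ℝ p z) z := by
      have h := HasDerivAt.comp_hasFDerivAt z (hasDerivAt_max_sq (p z - m)) (dp.sub_const m)
      exact h
    have dχ : HasFDerivAt χ (fderiv ℝ χ z) z :=
      ((χ.contDiff (n := 1)).differentiable one_ne_zero z).hasFDerivAt
    have h0 : ((max (p z - m) 0) ^ 2) • fderiv ℝ χ z = 0 := by
      by_cases hz : z ∈ ball (0 : ℝ × ℝ) ρ
      · by_cases hpz : m ≤ p z
        · have hz' : ‖z‖ ≤ ‖z1‖ := hz1max (show z ∈ _ from ⟨ball_subset_closedBall hz, hpz⟩)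
          have : z ∈ ball (0 : ℝ × ℝ) χ.rIn := by
            simp only [mem_ball_zero_iff]
            show ‖z‖ < (‖z1‖ + ρ) / 2
            linarith
          rw [(χ.eventuallyEq_one_of_mem_ball this).fderiv_eq]
          have : fderiv ℝ (1 : ℝ × ℝ → ℝ) z = 0 := by
            exact fderiv_const_apply 1
          rw [this, smul_zero]
        · rw [max_eq_right (by linarith)]; simp
      · have hχ0 : χ z = 0 := χ.zero_of_le_dist (by simpa using hz)
        have : IsLocalMin χ z := by
          filter_upwards with y
          rw [hχ0]; exact χ.nonneg
        rw [this.fderiv_eq_zero, smul_zero]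
    have := (dχ.mul dψ).fderiv
    change fderiv ℝ φ z = _ at this
    rw [this, h0, add_zero, smul_smul]
    congr 1; ring
  have hInt0 := null_lag φ q hφ hφc hq
  set G : ℝ × ℝ → ℝ := fun z => -(fderiv ℝ φ z (1, 0) * fderiv ℝ q z (0, 1)
      - fderiv ℝ φ z (0, 1) * fderiv ℝ q z (1, 0)) with hG
  have hGe : ∀ z, G z = (2 * χ z * max (p z - m) 0) * (-(fderiv ℝ p z (1, 0) * fderiv ℝ q z (0, 1)
      - fderiv ℝ p z (0, 1) * fderiv ℝ q z (1, 0))) := by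
    intro z
    simp only [hG, hD, smul_apply, smul_eq_mul]; ring
  have hχ0 : ∀ z, z ∉ ball (0 : ℝ × ℝ) ρ → χ z = 0 := fun z hz =>
    χ.zero_of_le_dist (by simpa using hz)
  have hJ : ∀ z ∈ ball (0 : ℝ × ℝ) ρ, 0 ≤ -(fderiv ℝ p z (1, 0) * fderiv ℝ q z (0, 1)
      - fderiv ℝ p z (0, 1) * fderiv ℝ q z (1, 0)) := by
    intro z hz
    have := hQ z hz
    by_contra hc
    push Not at hc
    nlinarith [sq_nonneg (fderiv ℝ p z (1, 0)), sq_nonneg (fderiv ℝ p z (0, 1)),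
      sq_nonneg (fderiv ℝ q z (1, 0)), sq_nonneg (fderiv ℝ q z (0, 1))]
  have hG0 : 0 ≤ G := by
    intro z
    show 0 ≤ G z
    rw [hGe]
    by_cases hz : z ∈ ball (0 : ℝ × ℝ) ρ
    · have := hJ z hz
      have h1 : 0 ≤ χ z := χ.nonneg
      have h2 : 0 ≤ max (p z - m) 0 := le_max_right _ _
      positivity
    · rw [hχ0 z hz]; simp
  have hGcont : Continuous G :=
    (((cont_dir φ hφ _).mul (cont_dir q hq _)).sub ((cont_dir φ hφ _).mul (cont_dir q hq _))).neg
  have hGcs : HasCompactSupport G := by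
    refine (hφc.fderiv ℝ).mono' ?_
    intro z hz
    apply subset_closure
    intro h; apply hz; simp [hG, h]
  have hGint : Integrable G := hGcont.integrable_of_hasCompactSupport hGcs
  have hGz : G = 0 := by
    have h1 : ∫ z, G z = 0 := by rw [hG, integral_neg, hInt0, neg_zero]
    have h2 := (integral_eq_zero_iff_of_nonneg hG0 hGint).1 h1
    exact (hGcont.ae_eq_iff_eq volume continuous_zero).1 h2
  have hDz : ∀ z, fderiv ℝ φ z = 0 := by
    intro z
    rw [hD]
    by_cases hz : z ∈ ball (0 : ℝ × ℝ) ρ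
    · by_cases hpz : m < p z
      · have h1 : 0 < χ z := χ.pos_of_mem_ball hz
        have h2 : 0 < max (p z - m) 0 := lt_max_of_lt_left (by linarith)
        have h3 : G z = 0 := by rw [hGz]; rfl
        rw [hGe] at h3
        have h4 := (mul_eq_zero.1 h3).resolve_left (by positivity)
        have h5 := hQ z hz
        have h6 : -K * (fderiv ℝ p z (1, 0) * fderiv ℝ q z (0, 1)
          - fderiv ℝ p z (0, 1) * fderiv ℝ q z (1, 0)) = 0 := by
          rw [neg_mul, ← mul_neg, h4, mul_zero]
        rw [h6] at h5
        have a1 : fderiv ℝ p z (1, 0) = 0 := by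
          apply pow_eq_zero_iff (n := 2) (by norm_num) |>.1
          nlinarith [sq_nonneg (fderiv ℝ p z (1, 0)), sq_nonneg (fderiv ℝ p z (0, 1)),
            sq_nonneg (fderiv ℝ q z (1, 0)), sq_nonneg (fderiv ℝ q z (0, 1))]
        have a2 : fderiv ℝ p z (0, 1) = 0 := by
          apply pow_eq_zero_iff (n := 2) (by norm_num) |>.1
          nlinarith [sq_nonneg (fderiv ℝ p z (1, 0)), sq_nonneg (fderiv ℝ p z (0, 1)),
            sq_nonneg (fderiv ℝ q z (1, 0)), sq_nonneg (fderiv ℝ q z (0, 1))]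
        have : fderiv ℝ p z = 0 := by
          apply ContinuousLinearMap.ext
          rintro ⟨a, b⟩
          have : ((a, b) : ℝ × ℝ) = a • (1, 0) + b • (0, 1) := by simp
          rw [this, map_add, map_smul, map_smul, a1, a2]; simp
        rw [this, smul_zero]
      · rw [max_eq_right (by linarith)]; simp
    · rw [hχ0 z hz]; simp
  have hconst := is_const_of_fderiv_eq_zero (hφ.differentiable one_ne_zero) hDz z0 (ρ, 0)
  have e1 : φ (ρ, 0) = 0 := by
    simp only [hφdef]
    rw [hχ0 (ρ, 0) (by simp [Prod.norm_def, le_abs_self]), zero_mul]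
  have e2 : 0 < φ z0 := by
    have h1 : 0 < χ z0 := χ.pos_of_mem_ball (by simpa using hz0ρ)
    have h2 : 0 < max (p z0 - m) 0 := lt_max_of_lt_left (by linarith)
    simp only [hφdef]
    positivity
  linarith

lemma caccioppoli_alg {K a b c d η e n1 n2 ω B : ℝ} (hK : 0 < K) (hη0 : 0 ≤ η)
    (he : |e| ≤ ω) (h1 : |n1| ≤ B) (h2 : |n2| ≤ B)
    (hQ : a ^ 2 + b ^ 2 + c ^ 2 + d ^ 2 ≤ -K * (a * d - b * c)) :
    η ^ 2 * (a ^ 2 + b ^ 2) ≤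
      2 * K * (-((η ^ 2 * a + 2 * η * e * n1) * d - (η ^ 2 * b + 2 * η * e * n2) * c))
        + 8 * K ^ 2 * ω ^ 2 * B ^ 2 := by
  have hω : 0 ≤ ω := (abs_nonneg _).trans he
  have hB : 0 ≤ B := (abs_nonneg _).trans h1
  have k1 : (e * n1) ^ 2 ≤ ω ^ 2 * B ^ 2 := by
    rw [← mul_pow, sq_le_sq, abs_mul, abs_of_nonneg (mul_nonneg hω hB)]
    exact mul_le_mul he h1 (abs_nonneg _) hω
  have k2 : (e * n2) ^ 2 ≤ ω ^ 2 * B ^ 2 := by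
    rw [← mul_pow, sq_le_sq, abs_mul, abs_of_nonneg (mul_nonneg hω hB)]
    exact mul_le_mul he h2 (abs_nonneg _) hω
  have k3 := mul_le_mul_of_nonneg_left hQ (sq_nonneg η)
  have k4 := mul_le_mul_of_nonneg_left k1 (sq_nonneg K)
  have k5 := mul_le_mul_of_nonneg_left k2 (sq_nonneg K)
  nlinarith [sq_nonneg (η * d - 2 * K * (e * n1)), sq_nonneg (η * c + 2 * K * (e * n2)),
    sq_nonneg (η * a), sq_nonneg (η * b)]

lemma caccioppoli {K : ℝ} (hK : 0 < K) : ∃ C0 : ℝ, 0 < C0 ∧ ∀ (p q : ℝ × ℝ → ℝ)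
    (_ : ContDiff ℝ 1 p) (_ : ContDiff ℝ 1 q) (_ : QR K p q (ball 0 1)) (c ω : ℝ)
    (_ : ∀ z ∈ ball (0 : ℝ × ℝ) 1, |p z - c| ≤ ω),
    ∫ z in closedBall (0 : ℝ × ℝ) (1 / 2), ((fderiv ℝ p z (1, 0)) ^ 2 + (fderiv ℝ p z (0, 1)) ^ 2)
      ≤ C0 * ω ^ 2 := by
  let χ : ContDiffBump (0 : ℝ × ℝ) := ⟨1 / 2, 1, by norm_num, by norm_num⟩
  have hχ1 : ContDiff ℝ 1 χ := χ.contDiff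
  obtain ⟨B0, hB0⟩ := (χ.hasCompactSupport.fderiv ℝ).exists_bound_of_continuous
    (hχ1.continuous_fderiv one_ne_zero)
  set B := max B0 0
  have hB : ∀ z v, ‖v‖ ≤ 1 → |fderiv ℝ χ z v| ≤ B := by
    intro z v hv
    have h1 := (fderiv ℝ χ z).le_opNorm v
    have h2 : ‖fderiv ℝ χ z‖ * ‖v‖ ≤ B * 1 :=
      mul_le_mul ((hB0 z).trans (le_max_left _ _)) hv (norm_nonneg _) (le_max_right _ _)
    rw [mul_one] at h2
    exact h1.trans h2
  set V := volume.real (closedBall (0 : ℝ × ℝ) 1)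
  refine ⟨8 * K ^ 2 * B ^ 2 * V + 1, by positivity, ?_⟩
  intro p q hp hq hQ c ω hω
  set φ : ℝ × ℝ → ℝ := fun z => (χ z) ^ 2 * (p z - c) with hφdef
  have hφ : ContDiff ℝ 1 φ := (hχ1.pow 2).mul (hp.sub contDiff_const)
  have hφc : HasCompactSupport φ := by
    refine χ.hasCompactSupport.mono' ?_
    intro z hz
    apply subset_closure
    intro h; apply hz; simp [hφdef, h]
  have hD : ∀ z v, fderiv ℝ φ z v =
      (χ z) ^ 2 * fderiv ℝ p z v + 2 * χ z * (p z - c) * fderiv ℝ χ z v := by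
    intro z v
    have dp : HasFDerivAt p (fderiv ℝ p z) z := (hp.differentiable one_ne_zero z).hasFDerivAt
    have dχ : HasFDerivAt χ (fderiv ℝ χ z) z := (hχ1.differentiable one_ne_zero z).hasFDerivAt
    have := ((dχ.pow 2).mul (dp.sub_const c)).fderiv
    change fderiv ℝ φ z = _ at this
    rw [this]
    simp
    ring
  have hInt0 := null_lag φ q hφ hφc hq
  set G : ℝ × ℝ → ℝ := fun z => -(fderiv ℝ φ z (1, 0) * fderiv ℝ q z (0, 1)
      - fderiv ℝ φ z (0, 1) * fderiv ℝ q z (1, 0)) with hG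
  have hGcont : Continuous G :=
    (((cont_dir φ hφ _).mul (cont_dir q hq _)).sub ((cont_dir φ hφ _).mul (cont_dir q hq _))).neg
  have hGcs : HasCompactSupport G := by
    refine (hφc.fderiv ℝ).mono' ?_
    intro z hz
    apply subset_closure
    intro h; apply hz; simp [hG, h]
  have hGint : Integrable G := hGcont.integrable_of_hasCompactSupport hGcs
  have h1 : ∫ z, G z = 0 := by rw [hG, integral_neg, hInt0, neg_zero]
  set g : ℝ × ℝ → ℝ := fun z => (fderiv ℝ p z (1, 0)) ^ 2 + (fderiv ℝ p z (0, 1)) ^ 2 with hg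
  have hgc : Continuous g := ((cont_dir p hp _).pow 2).add ((cont_dir p hp _).pow 2)
  have hgi : IntegrableOn g (closedBall (0 : ℝ × ℝ) (1 / 2)) :=
    hgc.continuousOn.integrableOn_compact (isCompact_closedBall _ _)
  have hci : IntegrableOn (fun _ => 8 * K ^ 2 * ω ^ 2 * B ^ 2) (closedBall (0 : ℝ × ℝ) 1) :=
    continuous_const.continuousOn.integrableOn_compact (isCompact_closedBall _ _)
  have hpt : ∀ z, (closedBall (0 : ℝ × ℝ) (1 / 2)).indicator g z ≤
      2 * K * G z + (closedBall (0 : ℝ × ℝ) 1).indicator (fun _ => 8 * K ^ 2 * ω ^ 2 * B ^ 2) z := by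
    intro z
    by_cases hz : z ∈ ball (0 : ℝ × ℝ) 1
    · rw [indicator_of_mem (ball_subset_closedBall hz)]
      have key := caccioppoli_alg (η := χ z) hK χ.nonneg (hω z hz)
        (hB z (1, 0) (by simp [Prod.norm_def])) (hB z (0, 1) (by simp [Prod.norm_def])) (hQ z hz)
      have : (closedBall (0 : ℝ × ℝ) (1 / 2)).indicator g z ≤ (χ z) ^ 2 * g z := by
        by_cases hz2 : z ∈ closedBall (0 : ℝ × ℝ) (1 / 2)
        · rw [indicator_of_mem hz2, χ.one_of_mem_closedBall hz2]; simp
        · rw [indicator_of_notMem hz2]; simp only [hg]; positivity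
      refine this.trans ?_
      simp only [hG, hD]
      exact key
    · have hχ0 : χ z = 0 := χ.zero_of_le_dist (by simpa using hz)
      have hG0 : G z = 0 := by simp only [hG, hD, hχ0]; ring
      rw [hG0, mul_zero, zero_add, indicator_of_notMem]
      · exact indicator_nonneg (fun _ _ => by positivity) z
      · intro h; apply hz
        simp only [mem_closedBall, mem_ball] at h ⊢; linarith
  have hfin := integral_mono (hgi.integrable_indicator measurableSet_closedBall)
    ((hGint.const_mul (2 * K)).add (hci.integrable_indicator measurableSet_closedBall)) hpt
  rw [integral_indicator measurableSet_closedBall] at hfin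
  have e : ∫ a, (2 * K * G a + (closedBall (0 : ℝ × ℝ) 1).indicator
      (fun _ => 8 * K ^ 2 * ω ^ 2 * B ^ 2) a) = V * (8 * K ^ 2 * ω ^ 2 * B ^ 2) := by
    rw [integral_add (hGint.const_mul (2 * K)) (hci.integrable_indicator measurableSet_closedBall),
      integral_const_mul, h1, integral_indicator measurableSet_closedBall, setIntegral_const]
    simp [V]
  have hfin2 : ∫ z in closedBall (0 : ℝ × ℝ) (1 / 2), g z ≤ V * (8 * K ^ 2 * ω ^ 2 * B ^ 2) :=
    hfin.trans e.le
  refine hfin2.trans ?_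
  nlinarith [sq_nonneg ω]

lemma seg_bound (f f' : ℝ → ℝ) (hf : ∀ t, HasDerivAt f (f' t) t) (hc : Continuous f')
    (g : ℝ → ℝ) (hg : Continuous g) (hfg : ∀ t, (f' t) ^ 2 ≤ g t)
    {ρ ε : ℝ} (hρ' : ρ ≤ 1 / 2) (hε : 0 < ε) {s t : ℝ}
    (hs : s ∈ Icc (-ρ) ρ) (ht : t ∈ Icc (-ρ) ρ) :
    |f s - f t| ≤ (2 * ρ * ε + (∫ x in Icc (-(1 / 2) : ℝ) (1 / 2), g x) / ε) / 2 := by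
  wlog hst : t ≤ s generalizing s t
  · rw [abs_sub_comm]; exact this ht hs (by linarith)
  have e1 : f s - f t = ∫ x in t..s, f' x :=
    (intervalIntegral.integral_eq_sub_of_hasDerivAt (fun x _ => hf x)
      (hc.intervalIntegrable _ _)).symm
  have hg0 : ∀ x, 0 ≤ g x := fun x => (sq_nonneg _).trans (hfg x)
  have e2 : |∫ x in t..s, f' x| ≤ ∫ x in t..s, (ε + g x / ε) / 2 := by
    refine (intervalIntegral.abs_integral_le_integral_abs hst).trans ?_
    apply intervalIntegral.integral_mono_on hst (hc.abs.intervalIntegrable _ _)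
    · apply Continuous.intervalIntegrable; fun_prop
    · intro x _
      have h1 : |f' x| * ε * 2 ≤ ε ^ 2 + g x := by
        have := hfg x
        rw [← sq_abs] at this
        nlinarith [sq_nonneg (|f' x| - ε)]
      rw [le_div_iff₀ (by norm_num), ← mul_le_mul_iff_left₀ hε, add_mul, div_mul_cancel₀ _ hε.ne']
      nlinarith
  have e3 : ∫ x in t..s, (ε + g x / ε) / 2 = ((s - t) * ε + (∫ x in t..s, g x) / ε) / 2 := by
    rw [intervalIntegral.integral_div, intervalIntegral.integral_add, intervalIntegral.integral_div,
      intervalIntegral.integral_const, smul_eq_mul]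
    · exact continuous_const.intervalIntegrable _ _
    · apply Continuous.intervalIntegrable; fun_prop
  have e4 : ∫ x in t..s, g x ≤ ∫ x in Icc (-(1 / 2) : ℝ) (1 / 2), g x := by
    rw [intervalIntegral.integral_of_le hst]
    apply setIntegral_mono_set
    · exact hg.continuousOn.integrableOn_compact isCompact_Icc
    · exact Eventually.of_forall hg0
    · apply Filter.Eventually.of_forall
      intro x hx
      exact ⟨by linarith [hx.1, ht.1], by linarith [hx.2, hs.2]⟩
  rw [e1]
  refine e2.trans ?_
  rw [e3]
  have h5 : (s - t) * ε ≤ 2 * ρ * ε := by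
    apply mul_le_mul_of_nonneg_right _ hε.le; linarith [hs.2, ht.1]
  have h6 : (∫ x in t..s, g x) / ε ≤ (∫ x in Icc (-(1 / 2) : ℝ) (1 / 2), g x) / ε := by gcongr
  linarith

lemma QR.neg {K : ℝ} {p q : ℝ × ℝ → ℝ} {s : Set (ℝ × ℝ)} (h : QR K p q s) :
    QR K (fun z => - p z) (fun z => - q z) s := by
  intro z hz
  have := h z hz
  simpa only [fderiv_fun_neg, neg_apply, neg_sq, neg_mul_neg] using this

lemma QR.rot {K : ℝ} {p q : ℝ × ℝ → ℝ} {s : Set (ℝ × ℝ)} (h : QR K p q s) :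
    QR K q (fun z => - p z) s := by
  intro z hz
  have := h z hz
  simp only [fderiv_fun_neg, neg_apply, neg_sq]
  nlinarith

lemma osc_pt {K : ℝ} (hK : 0 < K) (p q : ℝ × ℝ → ℝ) (hp : ContDiff ℝ 1 p) (hq : ContDiff ℝ 1 q)
    (hQ : QR K p q (ball 0 1)) (g : ℝ × ℝ → ℝ)
    (hg : g = fun z => (fderiv ℝ p z (1, 0)) ^ 2 + (fderiv ℝ p z (0, 1)) ^ 2)
    {ρ ε : ℝ} (hρ : 0 < ρ) (hρ' : ρ ≤ 1 / 2) (hε : 0 < ε) (z z' : ℝ × ℝ)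
    (hz : z ∈ closedBall (0 : ℝ × ℝ) ρ) (hz' : z' ∈ closedBall (0 : ℝ × ℝ) ρ) :
    |p z - p z'| ≤ 8 * ρ * ε + ((∫ y in Icc (-(1 / 2) : ℝ) (1 / 2), g (ρ, y))
      + (∫ y in Icc (-(1 / 2) : ℝ) (1 / 2), g (-ρ, y))
      + (∫ x in Icc (-(1 / 2) : ℝ) (1 / 2), g (x, ρ))
      + (∫ x in Icc (-(1 / 2) : ℝ) (1 / 2), g (x, -ρ))) / ε := by
  have hgc : Continuous g := by
    rw [hg]; exact ((cont_dir p hp _).pow 2).add ((cont_dir p hp _).pow 2)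
  have hg0 : ∀ z, 0 ≤ g z := by intro z; rw [hg]; positivity
  have dp : ∀ z, HasFDerivAt p (fderiv ℝ p z) z :=
    fun z => (hp.differentiable one_ne_zero z).hasFDerivAt
  have vert : ∀ a : ℝ, ∀ s ∈ Icc (-ρ) ρ, ∀ t ∈ Icc (-ρ) ρ, |p (a, s) - p (a, t)| ≤
      (2 * ρ * ε + (∫ y in Icc (-(1 / 2) : ℝ) (1 / 2), g (a, y)) / ε) / 2 := by
    intro a s hs t ht
    refine seg_bound (fun t => p (a, t)) (fun t => fderiv ℝ p (a, t) (0, 1)) ?_ ?_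
      (fun t => g (a, t)) ?_ ?_ hρ' hε hs ht
    · intro t
      exact (dp (a, t)).comp_hasDerivAt t ((hasDerivAt_const t a).prodMk (hasDerivAt_id t))
    · exact (cont_dir p hp (0, 1)).comp (by fun_prop)
    · exact hgc.comp (by fun_prop)
    · intro t; rw [hg]; simp only; nlinarith [sq_nonneg (fderiv ℝ p (a, t) (1, 0))]
  have horz : ∀ a : ℝ, ∀ s ∈ Icc (-ρ) ρ, ∀ t ∈ Icc (-ρ) ρ, |p (s, a) - p (t, a)| ≤
      (2 * ρ * ε + (∫ y in Icc (-(1 / 2) : ℝ) (1 / 2), g (y, a)) / ε) / 2 := by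
    intro a s hs t ht
    refine seg_bound (fun t => p (t, a)) (fun t => fderiv ℝ p (t, a) (1, 0)) ?_ ?_
      (fun t => g (t, a)) ?_ ?_ hρ' hε hs ht
    · intro t
      exact (dp (t, a)).comp_hasDerivAt t ((hasDerivAt_id t).prodMk (hasDerivAt_const t a))
    · exact (cont_dir p hp (1, 0)).comp (by fun_prop)
    · exact hgc.comp (by fun_prop)
    · intro t; rw [hg]; simp only; nlinarith [sq_nonneg (fderiv ℝ p (t, a) (0, 1))]
  set X1 := ∫ y in Icc (-(1 / 2) : ℝ) (1 / 2), g (ρ, y) with hX1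
  set X2 := ∫ y in Icc (-(1 / 2) : ℝ) (1 / 2), g (-ρ, y) with hX2
  set X3 := ∫ y in Icc (-(1 / 2) : ℝ) (1 / 2), g (y, ρ) with hX3
  set X4 := ∫ y in Icc (-(1 / 2) : ℝ) (1 / 2), g (y, -ρ) with hX4
  have pos : ∀ X : ℝ, 0 ≤ X → 0 ≤ (2 * ρ * ε + X / ε) / 2 := fun X hX => by positivity
  have P1 := pos X1 (integral_nonneg fun _ => hg0 _)
  have P2 := pos X2 (integral_nonneg fun _ => hg0 _)
  have P3 := pos X3 (integral_nonneg fun _ => hg0 _)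
  have P4 := pos X4 (integral_nonneg fun _ => hg0 _)
  set Y1 := (2 * ρ * ε + X1 / ε) / 2 with hY1
  set Y2 := (2 * ρ * ε + X2 / ε) / 2 with hY2
  set Y3 := (2 * ρ * ε + X3 / ε) / 2 with hY3
  set Y4 := (2 * ρ * ε + X4 / ε) / 2 with hY4
  have hsum : Y1 + Y2 + Y3 + Y4 = 4 * ρ * ε + (X1 + X2 + X3 + X4) / ε / 2 := by
    simp only [hY1, hY2, hY3, hY4]; ring
  have mρ : ρ ∈ Icc (-ρ) ρ := ⟨by linarith, le_rfl⟩
  have mρ' : -ρ ∈ Icc (-ρ) ρ := ⟨le_rfl, by linarith⟩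
  have bd : ∀ b ∈ sphere (0 : ℝ × ℝ) ρ, |p b - p (ρ, ρ)| ≤ Y1 + Y2 + Y3 + Y4 := by
    rintro ⟨x, y⟩ hb
    have hb : max |x| |y| = ρ := by simpa [Prod.norm_def] using hb
    have hx : x ∈ Icc (-ρ) ρ := abs_le.1 (hb ▸ le_max_left _ _)
    have hy : y ∈ Icc (-ρ) ρ := abs_le.1 (hb ▸ le_max_right _ _)
    have hcase : |x| = ρ ∨ |y| = ρ := by
      rcases max_choice |x| |y| with h | h
      · left; rw [← h, hb]
      · right; rw [← h, hb]
    have v1 := vert ρ y hy ρ mρ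
    have h1 := horz ρ x hx ρ mρ
    have v2 := vert (-ρ) y hy ρ mρ
    have h2 := horz ρ (-ρ) mρ' ρ mρ
    have h3 := horz (-ρ) x hx ρ mρ
    have v3 := vert ρ (-ρ) mρ' ρ mρ
    rw [abs_le] at v1 h1 v2 h2 h3 v3
    rw [abs_le]
    rcases hcase with h | h
    · rcases eq_or_eq_neg_of_abs_eq h with h | h
      · subst h; constructor <;> linarith
      · rw [h]; constructor <;> linarith
    · rcases eq_or_eq_neg_of_abs_eq h with h | h
      · subst h; constructor <;> linarith
      · rw [h]; constructor <;> linarith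
  have hQ' : QR K p q (ball 0 ρ) := fun z hz => hQ z (ball_subset_ball (by linarith) hz)
  have up := max_principle hK p q hp hq hρ hQ' (p (ρ, ρ) + (Y1 + Y2 + Y3 + Y4))
    (fun b hb => by have := abs_le.1 (bd b hb); linarith)
  have dn := max_principle hK _ _ hp.neg hq.neg hρ hQ'.neg (-p (ρ, ρ) + (Y1 + Y2 + Y3 + Y4))
    (fun b hb => by have := abs_le.1 (bd b hb); linarith)
  have u1 := up z hz
  have u2 := up z' hz'
  have d1 := dn z hz
  have d2 := dn z' hz'
  have hfin : |p z - p z'| ≤ 2 * (Y1 + Y2 + Y3 + Y4) := by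
    rw [abs_le]; constructor <;> linarith
  rw [hsum] at hfin
  linarith

lemma half_int (A : ℝ → ℝ) (hA : Continuous A) (hA0 : ∀ x, 0 ≤ A x) {θ : ℝ} (hθ : 0 < θ)
    (hθ' : θ ≤ 1 / 2) :
    (∫ x in θ..(1 / 2), A x) ≤ ∫ x in Icc (-(1 / 2) : ℝ) (1 / 2), A x ∧
    (∫ x in θ..(1 / 2), A (-x)) ≤ ∫ x in Icc (-(1 / 2) : ℝ) (1 / 2), A x := by
  have gen : ∀ a b : ℝ, a ≤ b → -(1 / 2) ≤ a → b ≤ 1 / 2 →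
      (∫ x in a..b, A x) ≤ ∫ x in Icc (-(1 / 2) : ℝ) (1 / 2), A x := by
    intro a b hab ha hb
    rw [intervalIntegral.integral_of_le hab]
    apply setIntegral_mono_set
    · exact hA.continuousOn.integrableOn_compact isCompact_Icc
    · exact Eventually.of_forall hA0
    · apply Filter.Eventually.of_forall
      intro x hx
      exact ⟨by linarith [hx.1], by linarith [hx.2]⟩
  refine ⟨gen _ _ hθ' (by linarith) le_rfl, ?_⟩
  rw [intervalIntegral.integral_comp_neg]
  exact gen _ _ (by linarith) le_rfl (by linarith)

lemma decay {K : ℝ} (hK : 0 < K) : ∃ θ : ℝ, 0 < θ ∧ θ < 1 / 2 ∧ ∀ (p q : ℝ × ℝ → ℝ)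
    (_ : ContDiff ℝ 1 p) (_ : ContDiff ℝ 1 q) (_ : QR K p q (ball 0 1)) (ω : ℝ)
    (_ : ∀ z ∈ ball (0 : ℝ × ℝ) 1, ∀ z' ∈ ball (0 : ℝ × ℝ) 1, |p z - p z'| ≤ ω),
    ∀ z ∈ closedBall (0 : ℝ × ℝ) θ, ∀ z' ∈ closedBall (0 : ℝ × ℝ) θ, |p z - p z'| ≤ ω / 2 := by
  obtain ⟨C0, hC0, hC⟩ := caccioppoli hK
  refine ⟨exp (-(512 * C0)) / 2, by positivity, ?_, ?_⟩
  · have : exp (-(512 * C0)) < 1 := by rw [exp_lt_one_iff]; linarith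
    linarith
  set θ := exp (-(512 * C0)) / 2 with hθ
  have hθ0 : 0 < θ := by positivity
  have hθ1 : θ ≤ 1 / 2 := by
    have : exp (-(512 * C0)) < 1 := by rw [exp_lt_one_iff]; linarith
    linarith
  have hlog : log ((1 / 2) / θ) = 512 * C0 := by
    have : (1 / 2) / θ = exp (512 * C0) := by
      rw [hθ, exp_neg]; field_simp
    rw [this, log_exp]
  intro p q hp hq hQ ω hω z hz z' hz'
  have hω0 : 0 ≤ ω := (abs_nonneg _).trans (hω 0 (by simp) 0 (by simp))
  have hE := hC p q hp hq hQ (p 0) ω (fun z hz => hω z hz 0 (by simp))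
  set g : ℝ × ℝ → ℝ := fun z => (fderiv ℝ p z (1, 0)) ^ 2 + (fderiv ℝ p z (0, 1)) ^ 2 with hg
  have hgc : Continuous g := ((cont_dir p hp _).pow 2).add ((cont_dir p hp _).pow 2)
  have hg0 : ∀ z, 0 ≤ g z := by intro z; rw [hg]; positivity
  set A : ℝ → ℝ := fun x => ∫ y in Icc (-(1 / 2) : ℝ) (1 / 2), g (x, y) with hA
  set B : ℝ → ℝ := fun y => ∫ x in Icc (-(1 / 2) : ℝ) (1 / 2), g (x, y) with hB
  have hAc : Continuous A :=
    continuous_parametric_integral_of_continuous (f := fun x y => g (x, y)) hgc isCompact_Icc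
  have hBc : Continuous B :=
    continuous_parametric_integral_of_continuous (f := fun y x => g (x, y))
      (hgc.comp continuous_swap) isCompact_Icc
  have hA0 : ∀ x, 0 ≤ A x := fun x => integral_nonneg fun _ => hg0 _
  have hB0 : ∀ x, 0 ≤ B x := fun x => integral_nonneg fun _ => hg0 _
  have hball : closedBall (0 : ℝ × ℝ) (1 / 2) = Icc (-(1 / 2) : ℝ) (1 / 2) ×ˢ Icc (-(1 / 2) : ℝ) (1 / 2) := by
    rw [show (0 : ℝ × ℝ) = (0, 0) from rfl, ← closedBall_prod_same, Real.closedBall_eq_Icc]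
    norm_num
  have hgi : IntegrableOn g (Icc (-(1 / 2) : ℝ) (1 / 2) ×ˢ Icc (-(1 / 2) : ℝ) (1 / 2)) (volume.prod volume) :=
    hgc.continuousOn.integrableOn_compact (isCompact_Icc.prod isCompact_Icc)
  rw [hball, Measure.volume_eq_prod] at hE
  have EA : ∫ x in Icc (-(1 / 2) : ℝ) (1 / 2), A x ≤ C0 * ω ^ 2 := by
    rw [setIntegral_prod _ hgi] at hE; exact hE
  have EB : ∫ x in Icc (-(1 / 2) : ℝ) (1 / 2), B x ≤ C0 * ω ^ 2 := by
    have : ∫ x in Icc (-(1 / 2) : ℝ) (1 / 2), B x = ∫ x in Icc (-(1 / 2) : ℝ) (1 / 2), A x := by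
      simp only [hA, hB]
      apply integral_integral_swap
      rw [Measure.prod_restrict]
      exact (hgc.comp continuous_swap).continuousOn.integrableOn_compact
        (isCompact_Icc.prod isCompact_Icc)
    rw [this]; exact EA
  set o := |p z - p z'| with ho
  rcases (abs_nonneg (p z - p z')).eq_or_lt with h0 | h0
  · rw [ho, ← h0]; positivity
  rw [← ho] at h0
  have hpt : ∀ ρ ∈ Icc θ (1 / 2), o ^ 2 / 32 * ρ⁻¹ ≤ A ρ + A (-ρ) + B ρ + B (-ρ) := by
    intro ρ hρ
    have hρ0 : 0 < ρ := hθ0.trans_le hρ.1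
    have := osc_pt hK p q hp hq hQ g hg hρ0 hρ.2 (ε := o / (16 * ρ)) (by positivity) z z'
      (closedBall_subset_closedBall hρ.1 hz) (closedBall_subset_closedBall hρ.1 hz')
    change o ≤ 8 * ρ * (o / (16 * ρ)) + (A ρ + A (-ρ) + B ρ + B (-ρ)) / (o / (16 * ρ)) at this
    set S := A ρ + A (-ρ) + B ρ + B (-ρ)
    have e1 : 8 * ρ * (o / (16 * ρ)) = o / 2 := by field_simp; norm_num
    have e2 : S / (o / (16 * ρ)) = 16 * ρ * S / o := by field_simp
    rw [e1, e2] at this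
    have h3 : o / 2 ≤ 16 * ρ * S / o := by linarith
    rw [le_div_iff₀ h0] at h3
    rw [← div_eq_mul_inv, div_le_iff₀ hρ0]
    nlinarith
  have hInt0 := intervalIntegral.integral_mono_on (μ := volume) hθ1
    (f := fun ρ => o ^ 2 / 32 * ρ⁻¹) (g := fun ρ => A ρ + A (-ρ) + B ρ + B (-ρ))
    (by
      apply ContinuousOn.intervalIntegrable
      apply ContinuousOn.mul continuousOn_const
      apply ContinuousOn.inv₀ continuousOn_id
      intro x hx
      rw [uIcc_of_le hθ1] at hx
      exact (hθ0.trans_le hx.1).ne')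
    (by apply Continuous.intervalIntegrable; fun_prop) hpt
  rw [intervalIntegral.integral_const_mul, integral_inv_of_pos hθ0 (by norm_num), hlog] at hInt0
  rw [intervalIntegral.integral_add, intervalIntegral.integral_add, intervalIntegral.integral_add] at hInt0
  rotate_left
  all_goals try (apply Continuous.intervalIntegrable; fun_prop)
  obtain ⟨a1, a2⟩ := half_int A hAc hA0 hθ0 hθ1
  obtain ⟨b1, b2⟩ := half_int B hBc hB0 hθ0 hθ1
  have h4 : o ^ 2 / 32 * (512 * C0) ≤ 4 * (C0 * ω ^ 2) := by linarith
  have h5 : o ^ 2 ≤ (ω / 2) ^ 2 := by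
    have : C0 * (4 * o ^ 2) ≤ C0 * ω ^ 2 := by linarith
    have := le_of_mul_le_mul_left this hC0
    linarith
  exact abs_le_of_sq_le_sq h5 (by positivity) |> (le_abs_self _).trans

lemma decay_scaled {K θ : ℝ} (hdec : ∀ (p q : ℝ × ℝ → ℝ)
    (_ : ContDiff ℝ 1 p) (_ : ContDiff ℝ 1 q) (_ : QR K p q (ball 0 1)) (ω : ℝ)
    (_ : ∀ z ∈ ball (0 : ℝ × ℝ) 1, ∀ z' ∈ ball (0 : ℝ × ℝ) 1, |p z - p z'| ≤ ω),
    ∀ z ∈ closedBall (0 : ℝ × ℝ) θ, ∀ z' ∈ closedBall (0 : ℝ × ℝ) θ, |p z - p z'| ≤ ω / 2)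
    (p q : ℝ × ℝ → ℝ) (hp : ContDiff ℝ 1 p) (hq : ContDiff ℝ 1 q) (z0 : ℝ × ℝ) {r : ℝ}
    (hr : 0 < r) (hQ : QR K p q (ball z0 r)) (ω : ℝ)
    (hω : ∀ z ∈ ball z0 r, ∀ z' ∈ ball z0 r, |p z - p z'| ≤ ω) :
    ∀ z ∈ closedBall z0 (θ * r), ∀ z' ∈ closedBall z0 (θ * r), |p z - p z'| ≤ ω / 2 := by
  have hmem : ∀ z ∈ ball (0 : ℝ × ℝ) 1, z0 + r • z ∈ ball z0 r := by
    intro z hz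
    rw [mem_ball_zero_iff] at hz
    rw [mem_ball, dist_eq_norm, add_sub_cancel_left, norm_smul, Real.norm_of_nonneg hr.le]
    nlinarith
  have sc : ∀ g : ℝ × ℝ → ℝ, ContDiff ℝ 1 g → ContDiff ℝ 1 (fun z => g (z0 + r • z)) ∧
      ∀ z v, fderiv ℝ (fun z => g (z0 + r • z)) z v = r * fderiv ℝ g (z0 + r • z) v := by
    intro g hg
    refine ⟨hg.comp (by fun_prop), ?_⟩
    intro z v
    have d1 : HasFDerivAt (fun z : ℝ × ℝ => z0 + r • z) (r • ContinuousLinearMap.id ℝ (ℝ × ℝ)) z :=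
      ((hasFDerivAt_id z).const_smul r).const_add z0
    have d2 : HasFDerivAt g (fderiv ℝ g (z0 + r • z)) (z0 + r • z) :=
      (hg.differentiable one_ne_zero _).hasFDerivAt
    have := (HasFDerivAt.comp z d2 d1).fderiv
    change fderiv ℝ (fun z => g (z0 + r • z)) z = _ at this
    rw [this]; simp
  obtain ⟨cp, fp⟩ := sc p hp
  obtain ⟨cq, fq⟩ := sc q hq
  have key := hdec _ _ cp cq (by
    intro z hz
    have := hQ _ (hmem z hz)
    simp only [fp, fq]
    have := mul_le_mul_of_nonneg_left this (sq_nonneg r)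
    nlinarith) ω (fun z hz z' hz' => hω _ (hmem z hz) _ (hmem z' hz'))
  have back : ∀ z ∈ closedBall z0 (θ * r), r⁻¹ • (z - z0) ∈ closedBall (0 : ℝ × ℝ) θ := by
    intro z hz
    rw [mem_closedBall, dist_eq_norm] at hz
    rw [mem_closedBall_zero_iff, norm_smul, norm_inv, Real.norm_of_nonneg hr.le,
      inv_mul_le_iff₀ hr]
    linarith
  intro z hz z' hz'
  have := key _ (back z hz) _ (back z' hz')
  simpa [smul_smul, mul_inv_cancel₀ hr.ne'] using this

lemma holder {K : ℝ} (hK : 0 < K) : ∃ α : ℝ, 0 < α ∧ α < 1 ∧ ∀ (p q : ℝ × ℝ → ℝ)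
    (_ : ContDiff ℝ 1 p) (_ : ContDiff ℝ 1 q) (z0 : ℝ × ℝ) (r : ℝ) (_ : 0 < r)
    (_ : QR K p q (ball z0 r)) (A : ℝ) (_ : ∀ z ∈ ball z0 r, |p z| ≤ A),
    ∀ y ∈ ball z0 r, |p y - p z0| ≤ 4 * A * (‖y - z0‖ / r) ^ α := by
  obtain ⟨θ, hθ0, hθ1, hdec⟩ := decay hK
  have hlθ : log θ < 0 := log_neg hθ0 (by linarith)
  have hl2 : log (1 / 2) < 0 := log_neg (by norm_num) (by norm_num)
  have hα0 : 0 < log (1 / 2) / log θ := div_pos_of_neg_of_neg hl2 hlθ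
  refine ⟨log (1 / 2) / log θ, hα0, ?_, ?_⟩
  · rw [div_lt_one_of_neg hlθ]
    exact log_lt_log hθ0 hθ1
  set α := log (1 / 2) / log θ with hα
  have hθα : θ ^ α = 1 / 2 := by
    rw [rpow_def_of_pos hθ0, hα, mul_div_cancel₀ _ hlθ.ne, exp_log (by norm_num)]
  intro p q hp hq z0 r hr hQ A hA y hy
  have hA0 : 0 ≤ A := (abs_nonneg _).trans (hA z0 (mem_ball_self hr))
  have iter : ∀ n : ℕ, ∀ z ∈ closedBall z0 (θ ^ n * r) ∩ ball z0 r,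
      ∀ z' ∈ closedBall z0 (θ ^ n * r) ∩ ball z0 r, |p z - p z'| ≤ 2 * A / 2 ^ n := by
    intro n
    induction n with
    | zero =>
      intro z hz z' hz'
      have h1 := abs_le.1 (hA z hz.2)
      have h2 := abs_le.1 (hA z' hz'.2)
      rw [abs_le]; constructor <;> simp <;> linarith
    | succ n ih =>
      intro z hz z' hz'
      have hle : θ ^ n * r ≤ r := by
        have : θ ^ n ≤ 1 := pow_le_one₀ hθ0.le (by linarith)
        nlinarith
      have := decay_scaled hdec p q hp hq z0 (r := θ ^ n * r) (by positivity)
        (fun z hz => hQ z (ball_subset_ball hle hz)) (2 * A / 2 ^ n)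
        (fun z hz z' hz' => ih z ⟨ball_subset_closedBall hz, ball_subset_ball hle hz⟩ z'
          ⟨ball_subset_closedBall hz', ball_subset_ball hle hz'⟩)
      have e : θ * (θ ^ n * r) = θ ^ (n + 1) * r := by ring
      rw [e] at this
      have := this z hz.1 z' hz'.1
      refine this.trans (le_of_eq ?_)
      rw [pow_succ]; field_simp
  by_cases hyz : y = z0
  · subst hyz; simp [zero_rpow hα0.ne']
  have hn : 0 < ‖y - z0‖ := norm_pos_iff.2 (sub_ne_zero.2 hyz)
  have hyr : ‖y - z0‖ < r := by rwa [mem_ball, dist_eq_norm] at hy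
  obtain ⟨n, hn1, hn2⟩ := exists_nat_pow_near_of_lt_one (x := ‖y - z0‖ / r) (y := θ)
    (by positivity) ((div_le_one hr).2 hyr.le) hθ0 (by linarith)
  have h1 := iter n y ⟨by rw [mem_closedBall, dist_eq_norm]; exact (div_le_iff₀ hr).1 hn2, hy⟩ z0
    ⟨mem_closedBall_self (by positivity), mem_ball_self hr⟩
  refine h1.trans ?_
  have h2 : (θ ^ (n + 1)) ^ α ≤ (‖y - z0‖ / r) ^ α :=
    rpow_le_rpow (by positivity) hn1.le hα0.le
  have h3 : (θ ^ (n + 1)) ^ α = (1 / 2) ^ (n + 1) := by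
    rw [← rpow_natCast, ← rpow_mul hθ0.le, mul_comm, rpow_mul hθ0.le, hθα, rpow_natCast]
  rw [h3] at h2
  have h4 := mul_le_mul_of_nonneg_left h2 (show 0 ≤ 4 * A by positivity)
  refine le_trans (le_of_eq ?_) h4
  rw [one_div, inv_pow, pow_succ]; field_simp; ring

lemma interp {α : ℝ} (hα0 : 0 < α) : ∃ C : ℝ, 0 < C ∧ ∀ (w : ℝ × ℝ → ℝ) (_ : ContDiff ℝ 2 w)
    (e : ℝ × ℝ) (_ : ‖e‖ ≤ 1) (z0 : ℝ × ℝ) (r : ℝ) (_ : 0 < r)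
    (_ : ∀ (z : ℝ × ℝ) (s A : ℝ), 0 < s → ball z s ⊆ ball z0 r →
      (∀ y ∈ ball z s, |fderiv ℝ w y e| ≤ A) →
      ∀ y ∈ ball z s, |fderiv ℝ w y e - fderiv ℝ w z e| ≤ 4 * A * (‖y - z‖ / s) ^ α)
    (M : ℝ) (_ : ∀ z ∈ ball z0 r, |w z| ≤ M), |fderiv ℝ w z0 e| ≤ C * M / r := by
  set τ : ℝ := (1 / 16) ^ (1 / α) with hτ
  have hτ0 : 0 < τ := by positivity
  have hτ1 : τ < 1 := rpow_lt_one (by norm_num) (by norm_num) (by positivity)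
  have hτα : τ ^ α = 1 / 16 := by
    rw [hτ, ← rpow_mul (by norm_num), one_div_mul_cancel hα0.ne', rpow_one]
  refine ⟨8 / τ, by positivity, ?_⟩
  intro w hw e he z0 r hr hH M hM
  set p : ℝ × ℝ → ℝ := fun z => fderiv ℝ w z e with hp
  have hpc : Continuous p := (hw.continuous_fderiv (by norm_num)).clm_apply continuous_const
  obtain ⟨z1, hz1, hmax⟩ := (isCompact_closedBall z0 r).exists_isMaxOn
    ⟨z0, mem_closedBall_self hr.le⟩
    (f := fun z => (r - ‖z - z0‖) * |p z|) (by fun_prop)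
  have hz1r : ‖z1 - z0‖ ≤ r := by rwa [mem_closedBall, dist_eq_norm] at hz1
  set d := r - ‖z1 - z0‖ with hd
  have hM0 : 0 ≤ M := (abs_nonneg _).trans (hM z0 (mem_ball_self hr))
  have h0 : r * |p z0| ≤ d * |p z1| := by
    have := hmax (mem_closedBall_self hr.le)
    simpa using this
  suffices hs : d * |p z1| ≤ 8 / τ * M by
    rw [le_div_iff₀ hr]
    linarith
  have hd0 : 0 ≤ d := by linarith
  rcases hd0.eq_or_lt with h | hdpos
  · rw [← h, zero_mul]; positivity
  have hsub : ball z1 d ⊆ ball z0 r := by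
    intro y hy
    rw [mem_ball, dist_eq_norm] at hy ⊢
    have : ‖y - z0‖ ≤ ‖y - z1‖ + ‖z1 - z0‖ := norm_sub_le_norm_sub_add_norm_sub _ _ _
    linarith
  have hsub2 : ball z1 (d / 2) ⊆ ball z0 r := (ball_subset_ball (by linarith)).trans hsub
  have hbd : ∀ y ∈ ball z1 (d / 2), |p y| ≤ 2 * |p z1| := by
    intro y hy
    have h1 : (r - ‖y - z0‖) * |p y| ≤ d * |p z1| := hmax (ball_subset_closedBall (hsub2 hy))
    have h2 : d / 2 ≤ r - ‖y - z0‖ := by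
      rw [mem_ball, dist_eq_norm] at hy
      have : ‖y - z0‖ ≤ ‖y - z1‖ + ‖z1 - z0‖ := norm_sub_le_norm_sub_add_norm_sub _ _ _
      linarith
    have h3 : d / 2 * |p y| ≤ d * |p z1| :=
      (mul_le_mul_of_nonneg_right h2 (abs_nonneg _)).trans h1
    have h4 : d * |p y| ≤ d * (2 * |p z1|) := by linarith
    exact le_of_mul_le_mul_left h4 hdpos
  have hhol := hH z1 (d / 2) (2 * |p z1|) (by linarith) hsub2 hbd
  set h := τ * d / 2 with hh
  have hhpos : 0 < h := by positivity
  have hmem : ∀ t ∈ Icc 0 h, z1 + t • e ∈ ball z1 (d / 2) := by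
    intro t ht
    rw [mem_ball, dist_eq_norm, add_sub_cancel_left, norm_smul, Real.norm_of_nonneg ht.1]
    have : t * ‖e‖ ≤ h * 1 := mul_le_mul ht.2 he (norm_nonneg _) hhpos.le
    nlinarith
  have hder : ∀ t, HasDerivAt (fun t : ℝ => w (z1 + t • e)) (p (z1 + t • e)) t := by
    intro t
    have d1 : HasDerivAt (fun t : ℝ => z1 + t • e) e t := by
      simpa using ((hasDerivAt_id t).smul_const e).const_add z1
    have d2 : HasFDerivAt w (fderiv ℝ w (z1 + t • e)) (z1 + t • e) :=
      (hw.differentiable (by norm_num) _).hasFDerivAt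
    exact d2.comp_hasDerivAt t d1
  obtain ⟨ξ, hξ, hslope⟩ := exists_hasDerivAt_eq_slope (fun t : ℝ => w (z1 + t • e))
    (fun t => p (z1 + t • e)) hhpos (fun t _ => (hder t).continuousAt.continuousWithinAt)
    (fun t _ => hder t)
  have hξm := hmem ξ ⟨hξ.1.le, hξ.2.le⟩
  have h1 := hhol _ hξm
  have h2 : (‖z1 + ξ • e - z1‖ / (d / 2)) ^ α ≤ τ ^ α := by
    apply rpow_le_rpow (by positivity) _ hα0.le
    rw [div_le_iff₀ (by positivity), add_sub_cancel_left, norm_smul, Real.norm_of_nonneg hξ.1.le]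
    have : ξ * ‖e‖ ≤ h * 1 := mul_le_mul hξ.2.le he (norm_nonneg _) hhpos.le
    linarith
  have h3 : |p (z1 + ξ • e) - p z1| ≤ |p z1| / 2 := by
    refine h1.trans ?_
    have := mul_le_mul_of_nonneg_left h2 (show 0 ≤ 4 * (2 * |p z1|) by positivity)
    rw [hτα] at this
    linarith
  have h4 : |p z1| / 2 ≤ |p (z1 + ξ • e)| := by
    have := abs_sub_abs_le_abs_sub (p z1) (p (z1 + ξ • e))
    rw [abs_sub_comm] at this
    linarith
  have h5 : |p (z1 + ξ • e)| * h ≤ 2 * M := by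
    rw [hslope, abs_div, sub_zero, abs_of_pos hhpos, div_mul_cancel₀ _ hhpos.ne']
    have a1 := abs_le.1 (hM _ (hsub2 (hmem h ⟨hhpos.le, le_rfl⟩)))
    have a2 := abs_le.1 (hM _ (hsub2 (hmem 0 ⟨le_rfl, hhpos.le⟩)))
    rw [abs_le]; constructor <;> linarith
  have h6 : |p z1| / 2 * h ≤ 2 * M := (mul_le_mul_of_nonneg_right h4 hhpos.le).trans h5
  rw [div_mul_eq_mul_div, le_div_iff₀ hτ0]
  rw [hh] at h6
  linarith

lemma core {K : ℝ} (hK : 0 < K) : ∃ α C : ℝ, 0 < α ∧ α < 1 ∧ 0 < C ∧ ∀ (w : ℝ × ℝ → ℝ)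
    (_ : ContDiff ℝ 2 w) (z0 : ℝ × ℝ) (r : ℝ) (_ : 0 < r)
    (_ : QR K (fun z => fderiv ℝ w z (1, 0)) (fun z => fderiv ℝ w z (0, 1)) (ball z0 r))
    (M : ℝ) (_ : ∀ z ∈ ball z0 r, |w z| ≤ M) (e : ℝ × ℝ) (_ : e = (1, 0) ∨ e = (0, 1)),
    |fderiv ℝ w z0 e| ≤ C * M / r ∧
    ∀ y ∈ ball z0 (r / 2), |fderiv ℝ w y e - fderiv ℝ w z0 e| ≤ C * M / r * (‖y - z0‖ / r) ^ α := by
  obtain ⟨α, hα0, hα1, hhol⟩ := holder hK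
  obtain ⟨C, hC, hInt0⟩ := interp hα0
  refine ⟨α, 16 * C, hα0, hα1, by positivity, ?_⟩
  intro w hw z0 r hr hQ M hM e he
  have hM0 : 0 ≤ M := (abs_nonneg _).trans (hM z0 (mem_ball_self hr))
  have cd : ∀ v : ℝ × ℝ, ContDiff ℝ 1 (fun z => fderiv ℝ w z v) := fun v =>
    (hw.fderiv_right (m := 1) (by norm_num)).clm_apply contDiff_const
  have hne : ‖e‖ ≤ 1 := by rcases he with rfl | rfl <;> simp [Prod.norm_def]
  have H : ∀ (z : ℝ × ℝ) (s A : ℝ), 0 < s → ball z s ⊆ ball z0 r →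
      (∀ y ∈ ball z s, |fderiv ℝ w y e| ≤ A) →
      ∀ y ∈ ball z s, |fderiv ℝ w y e - fderiv ℝ w z e| ≤ 4 * A * (‖y - z‖ / s) ^ α := by
    intro z s A hs hsub hA
    have hQ' := fun y hy => hQ y (hsub hy)
    rcases he with rfl | rfl
    · exact hhol _ _ (cd _) (cd _) z s hs hQ' A hA
    · exact hhol _ _ (cd _) (cd _).neg z s hs (QR.rot hQ') A hA
  have hb : ∀ z s, 0 < s → ball z s ⊆ ball z0 r → |fderiv ℝ w z e| ≤ C * M / s := by
    intro z s hs hsub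
    exact hInt0 w hw e hne z s hs (fun z' s' A hs' hsub' => H z' s' A hs' (hsub'.trans hsub)) M
      (fun y hy => hM y (hsub hy))
  constructor
  · refine (hb z0 r hr subset_rfl).trans ?_
    gcongr
    nlinarith
  · have hb2 : ∀ y ∈ ball z0 (r / 2), |fderiv ℝ w y e| ≤ C * M / (r / 2) := by
      intro y hy
      apply hb y (r / 2) (by linarith)
      apply ball_subset_ball'
      rw [mem_ball] at hy; linarith
    intro y hy
    refine (H z0 (r / 2) _ (by linarith) (ball_subset_ball (by linarith)) hb2 y hy).trans ?_
    have e1 : ‖y - z0‖ / (r / 2) = 2 * (‖y - z0‖ / r) := by field_simp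
    rw [e1, mul_rpow (by norm_num) (by positivity)]
    have h2 : (2 : ℝ) ^ α ≤ 2 := by
      calc (2 : ℝ) ^ α ≤ 2 ^ (1 : ℝ) := rpow_le_rpow_of_exponent_le (by norm_num) hα1.le
        _ = 2 := rpow_one 2
    have e2 : 16 * C * M / r * (‖y - z0‖ / r) ^ α
      = 4 * (C * M / (r / 2)) * (2 * (‖y - z0‖ / r) ^ α) := by field_simp; ring
    rw [e2]
    gcongr

def D2 (v : ℝ × ℝ → ℝ) (e f z : ℝ × ℝ) : ℝ := fderiv ℝ (fun y => fderiv ℝ v y f) z e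

def IsB (e : ℝ × ℝ) : Prop := e = (1, 0) ∨ e = (0, 1)

lemma IsB.norm {e : ℝ × ℝ} (he : IsB e) : ‖e‖ = 1 := by
  rcases he with rfl | rfl <;> simp [Prod.norm_def]

def Ell (K a b c d : ℝ) : Prop := a ^ 2 + b ^ 2 + c ^ 2 + d ^ 2 ≤ -K * (a * d - b * c)

lemma line_deriv_v {v : ℝ × ℝ → ℝ} (hv : Differentiable ℝ v) (z e : ℝ × ℝ) (t : ℝ) :
    HasDerivAt (fun t : ℝ => v (z + t • e)) (fderiv ℝ v (z + t • e) e) t := by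
  have d1 : HasDerivAt (fun t : ℝ => z + t • e) e t := by
    simpa using ((hasDerivAt_id t).smul_const e).const_add z
  exact (hv (z + t • e)).hasFDerivAt.comp_hasDerivAt t d1

lemma slope_lim {g : ℝ × ℝ → ℝ} (hg : Differentiable ℝ g) (z e : ℝ × ℝ) :
    Tendsto (fun h : ℝ => h⁻¹ * (g (z + h • e) - g z)) (𝓝[>] 0) (𝓝 (fderiv ℝ g z e)) := by
  have h1 := line_deriv_v hg z e 0
  rw [hasDerivAt_iff_tendsto_slope_zero] at h1
  have h2 := h1.mono_left (nhdsWithin_mono (0 : ℝ)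
    (show Ioi (0 : ℝ) ⊆ {0}ᶜ from fun x hx => ne_of_gt hx))
  simpa using h2

lemma stage2 {K α C : ℝ} (hα0 : 0 < α) (hα1 : α < 1) (hC : 0 < C)
    (hcore : ∀ (w : ℝ × ℝ → ℝ)
    (_ : ContDiff ℝ 2 w) (z0 : ℝ × ℝ) (r : ℝ) (_ : 0 < r)
    (_ : QR K (fun z => fderiv ℝ w z (1, 0)) (fun z => fderiv ℝ w z (0, 1)) (ball z0 r))
    (M : ℝ) (_ : ∀ z ∈ ball z0 r, |w z| ≤ M) (e : ℝ × ℝ) (_ : e = (1, 0) ∨ e = (0, 1)),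
    |fderiv ℝ w z0 e| ≤ C * M / r ∧
    ∀ y ∈ ball z0 (r / 2), |fderiv ℝ w y e - fderiv ℝ w z0 e| ≤ C * M / r * (‖y - z0‖ / r) ^ α)
    (v : ℝ × ℝ → ℝ) (hv : ContDiff ℝ 2 v) (z0 : ℝ × ℝ) (M1 : ℝ)
    (hM1 : ∀ z ∈ ball z0 (1 / 8), ∀ e, IsB e → |fderiv ℝ v z e| ≤ M1)
    (hE : ∀ z ∈ ball z0 (1 / 8), ∀ z' ∈ ball z0 (1 / 8),
      Ell K (D2 v (1, 0) (1, 0) z - D2 v (1, 0) (1, 0) z')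
        (D2 v (0, 1) (1, 0) z - D2 v (0, 1) (1, 0) z')
        (D2 v (1, 0) (0, 1) z - D2 v (1, 0) (0, 1) z')
        (D2 v (0, 1) (0, 1) z - D2 v (0, 1) (0, 1) z'))
    (e f : ℝ × ℝ) (he : IsB e) (hf : IsB f) :
    |D2 v e f z0| ≤ 16 * C * M1 ∧
    ∀ y ∈ ball z0 (1 / 32), |D2 v e f y - D2 v e f z0| ≤ 16 * (16 * C * M1) * ‖y - z0‖ ^ α := by
  have hM10 : 0 ≤ M1 := (abs_nonneg _).trans (hM1 z0 (mem_ball_self (by norm_num)) e he)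
  have hvd : Differentiable ℝ v := hv.differentiable (by norm_num)
  have cd : ∀ v' : ℝ × ℝ, ContDiff ℝ 1 (fun z => fderiv ℝ v z v') := fun v' =>
    (hv.fderiv_right (m := 1) (by norm_num)).clm_apply contDiff_const
  have dd : ∀ v' : ℝ × ℝ, Differentiable ℝ (fun z => fderiv ℝ v z v') := fun v' =>
    (cd v').differentiable one_ne_zero
  have hshift : ∀ z ∈ ball z0 (1 / 16), ∀ t : ℝ, 0 ≤ t → t < 1 / 16 →
      z + t • e ∈ ball z0 (1 / 8) := by
    intro z hz t ht0 ht1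
    rw [mem_ball, dist_eq_norm] at hz ⊢
    have : ‖z + t • e - z0‖ ≤ ‖z - z0‖ + ‖t • e‖ := by
      rw [add_sub_right_comm]; exact norm_add_le _ _
    rw [norm_smul, he.norm, Real.norm_of_nonneg ht0] at this
    linarith
  -- the main estimate for the difference quotient
  have main : ∀ h : ℝ, 0 < h → h < 1 / 16 →
      |h⁻¹ * (fderiv ℝ v (z0 + h • e) f - fderiv ℝ v z0 f)| ≤ 16 * C * M1 ∧
      ∀ y ∈ ball z0 (1 / 32), |h⁻¹ * (fderiv ℝ v (y + h • e) f - fderiv ℝ v y f)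
        - h⁻¹ * (fderiv ℝ v (z0 + h • e) f - fderiv ℝ v z0 f)|
        ≤ 16 * (16 * C * M1) * ‖y - z0‖ ^ α := by
    intro h hh0 hh1
    set w : ℝ × ℝ → ℝ := fun z => h⁻¹ * (v (z + h • e) - v z) with hw
    have hvs : ContDiff ℝ 2 (fun z => v (z + h • e)) := hv.comp (by fun_prop)
    have hwc : ContDiff ℝ 2 w := contDiff_const.mul (hvs.sub hv)
    have fw : ∀ z e', fderiv ℝ w z e' = h⁻¹ * (fderiv ℝ v (z + h • e) e' - fderiv ℝ v z e') := by
      intro z e'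
      have d1 : HasFDerivAt (fun z => v (z + h • e)) (fderiv ℝ v (z + h • e)) z := by
        have := (hvs.differentiable (by norm_num) z).hasFDerivAt
        rwa [fderiv_comp_add_right] at this
      have := ((d1.sub (hvd z).hasFDerivAt).const_mul h⁻¹).fderiv
      change fderiv ℝ w z = _ at this
      rw [this]; simp
    have fw2 : ∀ z e' f', fderiv ℝ (fun y => fderiv ℝ w y f') z e'
        = h⁻¹ * (D2 v e' f' (z + h • e) - D2 v e' f' z) := by
      intro z e' f'
      simp_rw [fw]
      have d1 : HasFDerivAt (fun z => fderiv ℝ v (z + h • e) f')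
          (fderiv ℝ (fun y => fderiv ℝ v y f') (z + h • e)) z := by
        rw [hasFDerivAt_comp_add_right (f := fun y => fderiv ℝ v y f')]
        exact (dd f' _).hasFDerivAt
      have := ((d1.sub (dd f' z).hasFDerivAt).const_mul h⁻¹).fderiv
      have t2 := congrArg (fun l => l e') this
      simpa [D2] using t2
    have hQw : QR K (fun z => fderiv ℝ w z (1, 0)) (fun z => fderiv ℝ w z (0, 1))
        (ball z0 (1 / 16)) := by
      intro z hz
      have hz8 : z ∈ ball z0 (1 / 8) := ball_subset_ball (by norm_num) hz
      have := hE _ (hshift z hz h hh0.le hh1) z hz8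
      simp only [fw2]
      unfold Ell at this
      have := mul_le_mul_of_nonneg_left this (sq_nonneg h⁻¹)
      nlinarith
    have hwM : ∀ z ∈ ball z0 (1 / 16), |w z| ≤ M1 := by
      intro z hz
      obtain ⟨ξ, hξ, hs⟩ := exists_hasDerivAt_eq_slope (fun t : ℝ => v (z + t • e))
        (fun t => fderiv ℝ v (z + t • e) e) hh0
        (fun t _ => (line_deriv_v hvd z e t).continuousAt.continuousWithinAt)
        (fun t _ => line_deriv_v hvd z e t)
      have e1 : w z = fderiv ℝ v (z + ξ • e) e := by
        rw [hs, hw]; simp [div_eq_inv_mul]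
      rw [e1]
      exact hM1 _ (hshift z hz ξ hξ.1.le (by linarith [hξ.2])) e he
    obtain ⟨r1, r2⟩ := hcore w hwc z0 (1 / 16) (by norm_num) hQw M1 hwM f hf
    constructor
    · rw [← fw]; refine r1.trans (le_of_eq (by ring))
    · intro y hy
      rw [← fw, ← fw]
      refine (r2 y (by convert hy using 2; norm_num)).trans ?_
      have e1 : ‖y - z0‖ / (1 / 16) = 16 * ‖y - z0‖ := by ring
      rw [e1, mul_rpow (by norm_num) (norm_nonneg _)]
      have h2 : (16 : ℝ) ^ α ≤ 16 := by
        calc (16 : ℝ) ^ α ≤ 16 ^ (1 : ℝ) := rpow_le_rpow_of_exponent_le (by norm_num) hα1.le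
          _ = 16 := rpow_one 16
      have e2 : 16 * (16 * C * M1) * ‖y - z0‖ ^ α
        = C * M1 / (1 / 16) * (16 * ‖y - z0‖ ^ α) := by ring
      rw [e2]
      gcongr
  have hev : ∀ᶠ h : ℝ in 𝓝[>] 0, 0 < h ∧ h < 1 / 16 :=
    Ioo_mem_nhdsGT (by norm_num)
  constructor
  · refine le_of_tendsto (slope_lim (dd f) z0 e).abs ?_
    filter_upwards [hev] with h hh
    exact (main h hh.1 hh.2).1
  · intro y hy
    refine le_of_tendsto ((slope_lim (dd f) y e).sub (slope_lim (dd f) z0 e)).abs ?_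
    filter_upwards [hev] with h hh
    exact (main h hh.1 hh.2).2 y hy

lemma ell_scalar {k s1 s2 t1 t2 : ℝ} {lam Lam : ℝ} (hl : 0 < lam) (hL : lam ≤ Lam)
    (hs : t1 + t2 = -(s1 + s2)) (hp : t1 * t2 = s1 * s2) (hk : k = Lam / lam)
    (h1 : 0 ≤ Lam * (max s1 0 + max s2 0) - lam * (max (-s1) 0 + max (-s2) 0))
    (h2 : 0 ≤ Lam * (max t1 0 + max t2 0) - lam * (max (-t1) 0 + max (-t2) 0)) :
    (s1 + s2) ^ 2 - 2 * (s1 * s2) ≤ -(2 * k) * (s1 * s2) := by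
  have key : ∀ a b : ℝ, a ≤ 0 → 0 ≤ Lam * max b 0 - lam * (-a + max (-b) 0) →
      0 ≤ Lam * (-a + max (-b) 0) - lam * max b 0 →
      a ^ 2 + b ^ 2 ≤ -(2 * k) * (a * b) := by
    intro a b ha hA hB
    have hkl : k * lam = Lam := by rw [hk]; field_simp
    have hb : 0 ≤ b := by
      by_contra hb
      push Not at hb
      rw [max_eq_right hb.le, max_eq_left (by linarith)] at hA
      nlinarith
    rw [max_eq_left hb, max_eq_right (by linarith)] at hA hB
    have e1 : -a ≤ k * b := by
      have : lam * (-a) ≤ lam * (k * b) := by rw [← hkl] at hA; nlinarith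
      exact le_of_mul_le_mul_left this hl
    have e2 : b ≤ k * (-a) := by
      have : lam * b ≤ lam * (k * (-a)) := by rw [← hkl] at hB; nlinarith
      exact le_of_mul_le_mul_left this hl
    nlinarith [mul_le_mul_of_nonneg_left e1 (neg_nonneg.mpr ha), mul_le_mul_of_nonneg_left e2 hb]
  have ht : Lam * (max t1 0 + max t2 0) - lam * (max (-t1) 0 + max (-t2) 0) =
      Lam * (max (-s1) 0 + max (-s2) 0) - lam * (max s1 0 + max s2 0) := by
    have : (t1 + s1) * (t1 + s2) = 0 := by
      have : t2 = -(s1 + s2) - t1 := by linarith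
      rw [this] at hp; nlinarith
    rcases mul_eq_zero.mp this with h | h
    · have e1 : t1 = -s1 := by linarith
      have e2 : t2 = -s2 := by linarith
      rw [e1, e2, neg_neg, neg_neg]
    · have e1 : t1 = -s2 := by linarith
      have e2 : t2 = -s1 := by linarith
      rw [e1, e2, neg_neg, neg_neg]; ring
  rw [ht] at h2
  rcases le_total s1 0 with h | h
  · have := key s1 s2 h (by rw [max_eq_right h, max_eq_left (neg_nonneg.mpr h)] at h1; linarith)
      (by rw [max_eq_right h, max_eq_left (neg_nonneg.mpr h)] at h2; linarith)
    nlinarith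
  · rcases le_total s2 0 with h' | h'
    · have := key s2 s1 h'
        (by rw [max_eq_right h', max_eq_left (neg_nonneg.mpr h')] at h1; linarith)
        (by rw [max_eq_right h', max_eq_left (neg_nonneg.mpr h')] at h2; linarith)
      nlinarith
    · rw [max_eq_left h, max_eq_left h', max_eq_right (by linarith : -s1 ≤ 0),
        max_eq_right (by linarith : -s2 ≤ 0)] at h2
      have e1 : s1 + s2 ≤ 0 := by nlinarith
      have e2 : s1 = 0 := by linarith
      have e3 : s2 = 0 := by linarith
      rw [e2, e3]; simp

lemma ell_mat {lam Lam : ℝ} (hl : 0 < lam) (hL : lam ≤ Lam) {F : Mat2 → ℝ}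
    (hF : UniformlyElliptic lam Lam F) {M N : Mat2} (hM : M.IsHermitian) (hN : N.IsHermitian)
    (hFM : F M = 0) (hFN : F N = 0) :
    Ell (2 * (Lam / lam)) (M 0 0 - N 0 0) (M 1 0 - N 1 0) (M 0 1 - N 0 1) (M 1 1 - N 1 1) := by
  have hA : (M - N).IsHermitian := hM.sub hN
  have hB : (N - M).IsHermitian := hN.sub hM
  have h1 := hF M N hM hN
  have h2 := hF N M hN hM
  rw [hFM, hFN, sub_zero] at h1 h2
  simp only [posNorm, negNorm, dif_pos hA, dif_pos hB, Fin.sum_univ_two] at h1 h2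
  have t1 := hA.trace_eq_sum_eigenvalues
  have t2 := hB.trace_eq_sum_eigenvalues
  have d1 := hA.det_eq_prod_eigenvalues
  have d2 := hB.det_eq_prod_eigenvalues
  simp only [Matrix.trace, Matrix.diag, Fin.sum_univ_two, Fin.prod_univ_two, Matrix.det_fin_two,
    Matrix.sub_apply, RCLike.ofReal_real_eq_id, id] at t1 t2 d1 d2
  have hs : M 0 1 = M 1 0 := by simpa using hM.apply 1 0
  have hs' : N 0 1 = N 1 0 := by simpa using hN.apply 1 0
  have := ell_scalar hl hL (by linarith) (by rw [← d1, ← d2]; ring) rfl h1 h2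
  unfold Ell
  rw [← t1, ← d1] at this
  rw [hs, hs'] at this ⊢
  nlinarith

/-- the linear chart of the plane -/
def LL : ℝ × ℝ →L[ℝ] E2 :=
  (ContinuousLinearMap.fst ℝ ℝ ℝ).smulRight (EuclideanSpace.single 0 1 : E2) +
  (ContinuousLinearMap.snd ℝ ℝ ℝ).smulRight (EuclideanSpace.single 1 1 : E2)

lemma LL_apply (z : ℝ × ℝ) : LL z = z.1 • (EuclideanSpace.single 0 1 : E2) +
    z.2 • (EuclideanSpace.single 1 1 : E2) := by
  simp [LL]

lemma LL_e0 : LL (1, 0) = (EuclideanSpace.single 0 1 : E2) := by simp [LL_apply]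
lemma LL_e1 : LL (0, 1) = (EuclideanSpace.single 1 1 : E2) := by simp [LL_apply]

lemma LL_norm (z : ℝ × ℝ) : ‖LL z‖ ≤ 2 * ‖z‖ := by
  rw [LL_apply]
  refine (norm_add_le _ _).trans ?_
  rw [norm_smul, norm_smul]
  simp only [EuclideanSpace.norm_single, norm_one, mul_one]
  linarith [norm_fst_le z, norm_snd_le z]

lemma LL_inv (x : E2) : LL (x 0, x 1) = x := by
  rw [LL_apply]
  ext i
  fin_cases i <;> simp

lemma LL_inv_norm (x y : E2) : ‖((x 0, x 1) : ℝ × ℝ) - (y 0, y 1)‖ ≤ ‖x - y‖ := by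
  have h0 := PiLp.norm_apply_le (x - y) 0
  have h1 := PiLp.norm_apply_le (x - y) 1
  simp only [Prod.mk_sub_mk, Prod.norm_mk]
  exact max_le (by simpa using h0) (by simpa using h1)

lemma le_supAbs {u : E2 → ℝ} (hu : ContinuousOn u (closedBall 0 1)) {x : E2}
    (hx : x ∈ ball (0 : E2) 1) : |u x| ≤ supAbs u (ball 0 1) := by
  obtain ⟨B, hB⟩ := (isCompact_closedBall (0 : E2) 1).exists_bound_of_continuousOn hu
  have hB0 : 0 ≤ B := (norm_nonneg _).trans (hB x (ball_subset_closedBall hx))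
  unfold supAbs
  have hbdd : BddAbove (range fun x : E2 => ⨆ (_ : x ∈ ball (0 : E2) 1), |u x|) := by
    refine ⟨B, ?_⟩
    rintro _ ⟨y, rfl⟩
    exact Real.iSup_le (fun hy => hB y (ball_subset_closedBall hy)) hB0
  refine le_trans ?_ (le_ciSup hbdd x)
  have : Nonempty (x ∈ ball (0 : E2) 1) := ⟨hx⟩
  simp only [ciSup_const]
  exact le_rfl

lemma cutoff {u : E2 → ℝ} (hu : ContDiffOn ℝ 2 u (closedBall (0 : E2) 1)) :
    ∃ g : E2 → ℝ, ContDiff ℝ 2 g ∧ ∀ x ∈ ball (0 : E2) (7 / 8), g x = u x := by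
  let χ : ContDiffBump (0 : E2) := ⟨7 / 8, 15 / 16, by norm_num, by norm_num⟩
  refine ⟨fun x => χ x * u x, ?_, ?_⟩
  · rw [contDiff_iff_contDiffAt]
    intro x
    by_cases hx : x ∈ ball (0 : E2) 1
    · exact (χ.contDiff.contDiffAt).mul (hu.contDiffAt
        (mem_of_superset (isOpen_ball.mem_nhds hx) ball_subset_closedBall))
    · have hev : (fun x => χ x * u x) =ᶠ[𝓝 x] fun _ => 0 := by
        have : (closedBall (0 : E2) (15 / 16))ᶜ ∈ 𝓝 x := by
          refine isClosed_closedBall.isOpen_compl.mem_nhds ?_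
          simp only [mem_compl_iff, mem_closedBall, mem_ball] at hx ⊢
          push Not at hx ⊢
          linarith
        filter_upwards [this] with y hy
        have : χ y = 0 := χ.zero_of_le_dist (by
          simp only [mem_compl_iff, mem_closedBall] at hy
          push Not at hy
          exact hy.le)
        rw [this, zero_mul]
      exact contDiffAt_const.congr_of_eventuallyEq hev
  · intro x hx
    have : χ x = 1 := χ.one_of_mem_closedBall (ball_subset_closedBall hx)
    simp [this]

lemma hess_congr {u g : E2 → ℝ} {s : Set E2} (hs : IsOpen s) (h : ∀ x ∈ s, g x = u x)
    {x : E2} (hx : x ∈ s) : fderiv ℝ g x = fderiv ℝ u x ∧ hess g x = hess u x := by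
  have h1 : ∀ y ∈ s, fderiv ℝ g y = fderiv ℝ u y := fun y hy =>
    Filter.EventuallyEq.fderiv_eq (by filter_upwards [hs.mem_nhds hy] with z hz using h z hz)
  refine ⟨h1 x hx, ?_⟩
  unfold hess
  ext i j
  simp only [Matrix.of_apply]
  rw [Filter.EventuallyEq.fderiv_eq (f := fun y => fderiv ℝ u y (EuclideanSpace.single j 1))]
  filter_upwards [hs.mem_nhds hx] with z hz
  rw [h1 z hz]

lemma fderiv_chart {g : E2 → ℝ} (hg : ContDiff ℝ 2 g) (z w : ℝ × ℝ) :
    fderiv ℝ (fun z => g (LL z)) z w = fderiv ℝ g (LL z) (LL w) := by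
  have hd : Differentiable ℝ g := hg.differentiable (by norm_num)
  have := (hd (LL z)).hasFDerivAt.comp z LL.hasFDerivAt
  rw [show (fun z => g (LL z)) = g ∘ LL from rfl, this.fderiv]
  rfl

lemma D2_chart {g : E2 → ℝ} (hg : ContDiff ℝ 2 g) (z e f : ℝ × ℝ) :
    D2 (fun z => g (LL z)) e f z = fderiv ℝ (fun y => fderiv ℝ g y (LL f)) (LL z) (LL e) := by
  unfold D2
  simp only [fderiv_chart hg]
  have hd : Differentiable ℝ (fun y => fderiv ℝ g y (LL f)) :=
    ((hg.fderiv_right (m := 1) (by norm_num)).clm_apply contDiff_const).differentiable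
      (by norm_num)
  have := (hd (LL z)).hasFDerivAt.comp z LL.hasFDerivAt
  rw [show (fun y => fderiv ℝ g (LL y) (LL f)) = (fun y => fderiv ℝ g y (LL f)) ∘ LL from rfl,
    this.fderiv]
  rfl

lemma hess_herm {g : E2 → ℝ} (hg : ContDiff ℝ 2 g) (x : E2) : (hess g x).IsHermitian := by
  have hd : DifferentiableAt ℝ (fderiv ℝ g) x :=
    (hg.fderiv_right (m := 1) (by norm_num)).differentiable (by norm_num) x
  have hsym : IsSymmSndFDerivAt ℝ g x := hg.contDiffAt.isSymmSndFDerivAt (by simp)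
  have hform : ∀ v w : E2, fderiv ℝ (fun y => fderiv ℝ g y w) x v =
      fderiv ℝ (fderiv ℝ g) x v w := by
    intro v w
    rw [fderiv_clm_apply hd (differentiableAt_const w)]
    simp
  ext i j
  simp only [hess, Matrix.conjTranspose_apply, Matrix.of_apply, star_trivial, hform]
  exact hsym.eq _ _

end Helpers

/-- Nirenberg's interior `C^{2,ᾱ}` estimate: there are universal constants `ᾱ ∈ (0,1)` and
`C > 0` depending only on `lam, Lam` such that for any `C¹` uniformly elliptic `F` with
`F(0) = 0` and any classical solution `u ∈ C²(B̄₁)` of `F(D²u) = 0` in the unit disk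
`B₁ ⊂ ℝ²`, one has `u ∈ C^{2,ᾱ}(B̄_{1/2})` with
`‖u‖_{C^{2,ᾱ}(B̄_{1/2})} ≤ C ‖u‖_{L^∞(B₁)}`. -/
theorem nirenberg_interior_estimate (lam Lam : ℝ) (hlam : 0 < lam) (hLam : lam ≤ Lam) :
    ∃ α C : ℝ, α ∈ Set.Ioo (0 : ℝ) 1 ∧ 0 < C ∧
      ∀ (F : Mat2 → ℝ) (u : E2 → ℝ),
        ContDiff ℝ 1 (fun A : Fin 2 → Fin 2 → ℝ => F (Matrix.of A)) →
        UniformlyElliptic lam Lam F → F 0 = 0 →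
        ContDiffOn ℝ 2 u (closedBall (0 : E2) 1) →
        (∀ x ∈ ball (0 : E2) 1, F (hess u x) = 0) →
        (∀ x ∈ closedBall (0 : E2) (1 / 2),
          |u x| ≤ C * supAbs u (ball 0 1) ∧
          ‖fderiv ℝ u x‖ ≤ C * supAbs u (ball 0 1) ∧
          matNorm (hess u x) ≤ C * supAbs u (ball 0 1)) ∧
        (∀ x ∈ closedBall (0 : E2) (1 / 2), ∀ y ∈ closedBall (0 : E2) (1 / 2),
          matNorm (hess u x - hess u y) ≤ C * supAbs u (ball 0 1) * ‖x - y‖ ^ α) := by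
  have hLpos : 0 < Lam := hlam.trans_le hLam
  have hK : 0 < 2 * (Lam / lam) := by positivity
  obtain ⟨α, C, hα0, hα1, hC, hcore⟩ := core hK
  have hCf : 0 < 1 + 2 * (16 * C) + 256 * (16 * C * (16 * C)) := by positivity
  refine ⟨α, 1 + 2 * (16 * C) + 256 * (16 * C * (16 * C)), ⟨hα0, hα1⟩, hCf, ?_⟩
  intro F u _ hF hF0 hu heq
  obtain ⟨g, hg, hgu⟩ := cutoff hu
  set S := supAbs u (ball 0 1) with hS
  have huS : ∀ x ∈ ball (0 : E2) 1, |u x| ≤ S := fun x hx => le_supAbs hu.continuousOn hx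
  have hS0 : 0 ≤ S := (abs_nonneg _).trans (huS 0 (mem_ball_self one_pos))
  have hcong := fun {x : E2} (hx : x ∈ ball (0 : E2) (7 / 8)) => hess_congr isOpen_ball hgu hx
  have hsub : ∀ x ∈ ball (0 : E2) (7 / 8), x ∈ ball (0 : E2) 1 :=
    fun x hx => ball_subset_ball (by norm_num) hx
  have hFg : ∀ x ∈ ball (0 : E2) (7 / 8), F (hess g x) = 0 := by
    intro x hx
    rw [(hcong hx).2]
    exact heq x (hsub x hx)
  set v : ℝ × ℝ → ℝ := fun z => g (LL z) with hv
  have hvC : ContDiff ℝ 2 v := hg.comp LL.contDiff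
  have d00 : ∀ z, D2 v (1, 0) (1, 0) z = hess g (LL z) 0 0 := fun z => by
    rw [hv, D2_chart hg, LL_e0]; rfl
  have d10 : ∀ z, D2 v (0, 1) (1, 0) z = hess g (LL z) 1 0 := fun z => by
    rw [hv, D2_chart hg, LL_e0, LL_e1]; rfl
  have d01 : ∀ z, D2 v (1, 0) (0, 1) z = hess g (LL z) 0 1 := fun z => by
    rw [hv, D2_chart hg, LL_e0, LL_e1]; rfl
  have d11 : ∀ z, D2 v (0, 1) (0, 1) z = hess g (LL z) 1 1 := fun z => by
    rw [hv, D2_chart hg, LL_e1]; rfl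
  have hball : ∀ (z0 z : ℝ × ℝ) (a b : ℝ), ‖LL z0‖ ≤ a → z ∈ ball z0 b →
      ‖LL z‖ < a + 2 * b := by
    intro z0 z a b h0 hz
    have h1 : LL z = LL z0 + LL (z - z0) := by rw [map_sub]; abel
    have h2 := LL_norm (z - z0)
    rw [mem_ball, dist_eq_norm] at hz
    have h3 := norm_add_le (LL z0) (LL (z - z0))
    rw [← h1] at h3
    linarith
  have hmem : ∀ z, ‖LL z‖ < 7 / 8 → LL z ∈ ball (0 : E2) (7 / 8) := fun z hz => by
    simpa using hz
  -- first stage: gradient bound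
  have st1 : ∀ z0, ‖LL z0‖ ≤ 3 / 4 → ∀ e, IsB e → |fderiv ℝ v z0 e| ≤ 16 * C * S := by
    intro z0 hz0 e he
    have hin : ∀ z ∈ ball z0 (1 / 16), LL z ∈ ball (0 : E2) (7 / 8) := fun z hz =>
      hmem z (by have := hball z0 z _ _ hz0 hz; linarith)
    have := (hcore v hvC z0 (1 / 16) (by norm_num) ?_ S ?_ e he).1
    · calc _ ≤ _ := this
        _ = _ := by ring
    · intro z hz
      have h := ell_mat hlam hLam hF (hess_herm hg (LL z)) Matrix.isHermitian_zero
        (hFg _ (hin z hz)) hF0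
      simp only [Matrix.zero_apply, sub_zero] at h
      rw [← d00, ← d10, ← d01, ← d11] at h
      exact h
    · intro z hz
      rw [hv]
      simp only
      rw [hgu _ (hin z hz)]
      exact huS _ (hsub _ (hin z hz))
  have st2 : ∀ z0, ‖LL z0‖ ≤ 1 / 2 → ∀ e f, IsB e → IsB f →
      |D2 v e f z0| ≤ 16 * C * (16 * C * S) ∧
      ∀ y ∈ ball z0 (1 / 32),
        |D2 v e f y - D2 v e f z0| ≤ 16 * (16 * C * (16 * C * S)) * ‖y - z0‖ ^ α := by
    intro z0 hz0 e f he hf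
    refine stage2 hα0 hα1 hC hcore v hvC z0 (16 * C * S) ?_ ?_ e f he hf
    · intro z hz e he
      exact st1 z (by have := hball z0 z _ _ hz0 hz; linarith) e he
    · intro z hz z' hz'
      have h := ell_mat hlam hLam hF (hess_herm hg (LL z)) (hess_herm hg (LL z'))
        (hFg _ (hmem z (by have := hball z0 z _ _ hz0 hz; linarith)))
        (hFg _ (hmem z' (by have := hball z0 z' _ _ hz0 hz'; linarith)))
      simp only [← d00, ← d10, ← d01, ← d11] at h
      exact h
  set M2 := 16 * C * (16 * C * S) with hM2
  have hM20 : 0 ≤ M2 := by positivity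
  have b0 : IsB (1, 0) := Or.inl rfl
  have b1 : IsB (0, 1) := Or.inr rfl
  have hC1 : S ≤ (1 + 2 * (16 * C) + 256 * (16 * C * (16 * C))) * S := by
    have : 0 ≤ (2 * (16 * C) + 256 * (16 * C * (16 * C))) * S := by positivity
    nlinarith
  have hC2 : 2 * (16 * C * S) ≤ (1 + 2 * (16 * C) + 256 * (16 * C * (16 * C))) * S := by
    have : 0 ≤ (1 + 256 * (16 * C * (16 * C))) * S := by positivity
    nlinarith
  have hC3 : 256 * M2 ≤ (1 + 2 * (16 * C) + 256 * (16 * C * (16 * C))) * S := by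
    have : 0 ≤ (1 + 2 * (16 * C)) * S := by positivity
    rw [hM2]
    nlinarith
  have hhalf : ∀ x ∈ closedBall (0 : E2) (1 / 2), ‖x‖ ≤ 1 / 2 ∧ x ∈ ball (0 : E2) (7 / 8) := by
    intro x hx
    have h1 : ‖x‖ ≤ 1 / 2 := by simpa using hx
    exact ⟨h1, by simp only [mem_ball, dist_zero_right]; linarith⟩
  constructor
  · intro x hx
    obtain ⟨hx1, hx2⟩ := hhalf x hx
    have hxL := LL_inv x
    set z : ℝ × ℝ := (x 0, x 1) with hz
    have hzn : ‖LL z‖ ≤ 1 / 2 := by rw [hxL]; exact hx1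
    refine ⟨(huS x (hsub x hx2)).trans hC1, ?_, ?_⟩
    · refine le_trans ?_ hC2
      refine ContinuousLinearMap.opNorm_le_bound _ (by positivity) fun w => ?_
      rw [← (hcong hx2).1]
      have g0 := st1 z (by linarith) _ b0
      have g1 := st1 z (by linarith) _ b1
      rw [hv, fderiv_chart hg, hxL] at g0 g1
      have hw : w = w 0 • LL (1, 0) + w 1 • LL (0, 1) := by
        conv_lhs => rw [← LL_inv w, LL_apply]
        rw [LL_e0, LL_e1]
      have n0 : |w 0| ≤ ‖w‖ := by simpa using PiLp.norm_apply_le w 0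
      have n1 : |w 1| ≤ ‖w‖ := by simpa using PiLp.norm_apply_le w 1
      have hval : fderiv ℝ g x w = w 0 * fderiv ℝ g x (LL (1, 0)) +
          w 1 * fderiv ℝ g x (LL (0, 1)) := by
        conv_lhs => rw [hw]
        rw [map_add, map_smul, map_smul, smul_eq_mul, smul_eq_mul]
      rw [hval, Real.norm_eq_abs]
      refine (abs_add_le _ _).trans ?_
      rw [abs_mul, abs_mul]
      have m0 := mul_le_mul n0 g0 (abs_nonneg _) (norm_nonneg _)
      have m1 := mul_le_mul n1 g1 (abs_nonneg _) (norm_nonneg _)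
      linarith
    · refine le_trans ?_ hC3
      rw [← (hcong hx2).2]
      have a00 := (st2 z hzn _ _ b0 b0).1
      have a01 := (st2 z hzn _ _ b0 b1).1
      have a10 := (st2 z hzn _ _ b1 b0).1
      have a11 := (st2 z hzn _ _ b1 b1).1
      rw [d00, hxL] at a00
      rw [d01, hxL] at a01
      rw [d10, hxL] at a10
      rw [d11, hxL] at a11
      simp only [matNorm, Fin.sum_univ_two]
      linarith
  · intro x hx y hy
    obtain ⟨hx1, hx2⟩ := hhalf x hx
    obtain ⟨hy1, hy2⟩ := hhalf y hy
    have hxL := LL_inv x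
    have hyL := LL_inv y
    have hxy := LL_inv_norm x y
    set z : ℝ × ℝ := (x 0, x 1) with hz
    set z' : ℝ × ℝ := (y 0, y 1) with hz'
    have hzn : ‖LL z‖ ≤ 1 / 2 := by rw [hxL]; exact hx1
    have hzn' : ‖LL z'‖ ≤ 1 / 2 := by rw [hyL]; exact hy1
    have hpow : ‖z - z'‖ ^ α ≤ ‖x - y‖ ^ α := Real.rpow_le_rpow (norm_nonneg _) hxy hα0.le
    have hbd : ∀ e f, IsB e → IsB f →
        |D2 v e f z - D2 v e f z'| ≤ 64 * M2 * ‖x - y‖ ^ α := by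
      intro e f he hf
      have hnn : 0 ≤ ‖z - z'‖ ^ α := Real.rpow_nonneg (norm_nonneg _) _
      have hstep : 64 * M2 * ‖z - z'‖ ^ α ≤ 64 * M2 * ‖x - y‖ ^ α :=
        mul_le_mul_of_nonneg_left hpow (by positivity)
      refine le_trans ?_ hstep
      by_cases hd : ‖z - z'‖ < 1 / 32
      · have := (st2 z' hzn' e f he hf).2 z (by rw [mem_ball, dist_eq_norm]; exact hd)
        have h0 : 0 ≤ M2 * ‖z - z'‖ ^ α := mul_nonneg hM20 hnn
        linarith
      · push Not at hd
        have h1 := (st2 z hzn e f he hf).1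
        have h2 := (st2 z' hzn' e f he hf).1
        have h3 : (1 / 32 : ℝ) ≤ ‖z - z'‖ ^ α := by
          calc (1 / 32 : ℝ) = (1 / 32 : ℝ) ^ (1 : ℝ) := (Real.rpow_one _).symm
            _ ≤ (1 / 32 : ℝ) ^ α :=
              Real.rpow_le_rpow_of_exponent_ge (by norm_num) (by norm_num) hα1.le
            _ ≤ _ := Real.rpow_le_rpow (by norm_num) hd hα0.le
        have h4 := mul_le_mul_of_nonneg_left h3 (by positivity : 0 ≤ 64 * M2)
        have h5 := abs_sub (D2 v e f z) (D2 v e f z')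
        linarith
    have hfin : 256 * M2 * ‖x - y‖ ^ α ≤
        (1 + 2 * (16 * C) + 256 * (16 * C * (16 * C))) * S * ‖x - y‖ ^ α :=
      mul_le_mul_of_nonneg_right hC3 (Real.rpow_nonneg (norm_nonneg _) _)
    refine le_trans ?_ hfin
    rw [← (hcong hx2).2, ← (hcong hy2).2]
    have a00 := hbd _ _ b0 b0
    have a01 := hbd _ _ b0 b1
    have a10 := hbd _ _ b1 b0
    have a11 := hbd _ _ b1 b1
    rw [d00, d00, hxL, hyL] at a00
    rw [d01, d01, hxL, hyL] at a01
    rw [d10, d10, hxL, hyL] at a10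
    rw [d11, d11, hxL, hyL] at a11
    simp only [matNorm, Fin.sum_univ_two, Matrix.sub_apply]
    linarith
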